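/- arXiv:1004.1101 — 3 statements merged into one kernel-verified Lean document; each statement's English description precedes it below -/
import Mathlib

section
/- Let n ≥ 1, let Ω ⊆ ℝⁿ be open, and let n < p < ∞. Suppose u is locally integrable on Ω, f ∈ L^p_loc(Ω), and u is a distributional solution of Δu = f on Ω. Then u has a locally Lipschitz representative: there exists a function v : Ω → ℝ that is locally Lipschitz continuous on Ω and satisfies u = v almost everywhere on Ω. -/
open MeasureTheory Metric Set

/-- The Laplacian of a function on Euclidean space, as the sum of second
partial derivatives in the coordinate directions. -/
noncomputable def lap {n : ℕ} (u : EuclideanSpace ℝ (Fin n) → ℝ)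
    (x : EuclideanSpace ℝ (Fin n)) : ℝ :=
  ∑ i, fderiv ℝ (fun y => fderiv ℝ u y (EuclideanSpace.single i 1)) x
    (EuclideanSpace.single i 1)

open Filter Topology

/-- A smooth profile supported in `(-∞, 1]` and strictly decreasing on `(-∞, 1)`. -/
lemma exists_smooth_decreasing_profile :
    ∃ H : ℝ → ℝ, ContDiff ℝ (⊤ : ℕ∞) H ∧ (∀ s, 1 < s → H s = 0) ∧ (∀ s, deriv H s ≤ 0) ∧
      ∀ s < 1, deriv H s < 0 := by
  have hd : ∀ s, HasDerivAt (fun s : ℝ => expNegInvGlue (1 - s))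
      (-(((1 - s)⁻¹) ^ 2 * expNegInvGlue (1 - s))) s := by
    intro s
    have h := expNegInvGlue.hasDerivAt_polynomial_eval_inv_mul 1 (1 - s)
    simp only [Polynomial.eval_one, one_mul, Polynomial.derivative_one, sub_zero, mul_one,
      Polynomial.eval_pow, Polynomial.eval_X] at h
    have h2 := h.comp s ((hasDerivAt_id s).const_sub 1)
    rw [mul_neg_one] at h2
    exact h2
  refine ⟨fun s => expNegInvGlue (1 - s),
    expNegInvGlue.contDiff.comp (contDiff_const.sub contDiff_id),
    fun s hs => expNegInvGlue.zero_of_nonpos (by linarith), fun s => ?_, fun s hs => ?_⟩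
  · rw [(hd s).deriv]
    have := expNegInvGlue.nonneg (1 - s)
    rw [neg_nonpos]; positivity
  · rw [(hd s).deriv]
    have := expNegInvGlue.pos_of_pos (x := 1 - s) (by linarith)
    have h1 : 0 < 1 - s := by linarith
    rw [neg_lt_zero]; positivity

lemma deriv_eq_zero_of_one_lt {G : ℝ → ℝ} (hG : ∀ s, 1 < s → G s = 0) {s : ℝ} (hs : 1 < s) :
    deriv G s = 0 := by
  have : G =ᶠ[𝓝 s] fun _ => 0 := by
    filter_upwards [lt_mem_nhds hs] with a ha using hG a ha
  rw [this.deriv_eq, deriv_const]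

lemma exists_bound_of_eq_zero_of_one_lt {G : ℝ → ℝ} (hc : Continuous G)
    (hG : ∀ s, 1 < s → G s = 0) : ∃ M, 0 ≤ M ∧ ∀ s, 0 ≤ s → |G s| ≤ M := by
  obtain ⟨M, hM⟩ := (isCompact_Icc (a := (0 : ℝ)) (b := 1)).exists_bound_of_continuousOn
    hc.continuousOn
  have hM0 : 0 ≤ M := (norm_nonneg _).trans (hM 0 (by simp))
  refine ⟨M, hM0, fun s hs => ?_⟩
  rcases le_or_gt s 1 with h | h
  · exact hM s ⟨hs, h⟩
  · simpa [hG s h] using hM0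

/-- A bound `C t ^ (-α)`, `α < 1`, on the derivative of `h` controls its oscillation near zero. -/
lemma abs_le_abs_add_of_deriv_le_rpow {h h' : ℝ → ℝ} {C α r ε : ℝ} (hα : α < 1)
    (hC : 0 ≤ C) (hε : 0 < ε) (hεr : ε ≤ r)
    (hd : ∀ t ∈ Icc ε r, HasDerivAt h (h' t) t)
    (hb : ∀ t ∈ Icc ε r, |h' t| ≤ C * t ^ (-α)) :
    |h ε| ≤ |h r| + C * (r ^ (1 - α) / (1 - α)) := by
  have hα' : 0 < 1 - α := by linarith
  have hB : ∀ t ∈ Icc ε r, HasDerivAt (fun t : ℝ => C * (t ^ (1 - α) / (1 - α)))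
      (C * t ^ (-α)) t := by
    intro t ht
    have ht0 : t ≠ 0 := (hε.trans_le ht.1).ne'
    have := (((Real.hasDerivAt_rpow_const (p := 1 - α) (Or.inl ht0)).div_const (1 - α)).const_mul C)
    have e : C * ((1 - α) * t ^ (1 - α - 1) / (1 - α)) = C * t ^ (-α) := by
      rw [show 1 - α - 1 = -α by ring]
      field_simp
    rwa [e] at this
  have key : ∀ σ : ℝ, |σ| = 1 → σ * h ε ≤ σ * h r + C * (r ^ (1 - α) / (1 - α)) := by
    intro σ hσ
    have hm : MonotoneOn (fun t => σ * h t + C * (t ^ (1 - α) / (1 - α))) (Icc ε r) := by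
      refine monotoneOn_of_hasDerivWithinAt_nonneg (f' := fun t => σ * h' t + C * t ^ (-α))
        (convex_Icc _ _) ?_ ?_ ?_
      · exact fun t ht =>
          (((hd t ht).const_mul σ).add (hB t ht)).continuousAt.continuousWithinAt
      · exact fun t ht => (((hd t (interior_subset ht)).const_mul σ).add
          (hB t (interior_subset ht))).hasDerivWithinAt
      · intro t ht
        have h1 := hb t (interior_subset ht)
        have h2 : |σ * h' t| ≤ C * t ^ (-α) := by rw [abs_mul, hσ, one_mul]; exact h1
        linarith [(abs_le.1 h2).1]
    have h1 := hm (left_mem_Icc.2 hεr) (right_mem_Icc.2 hεr) hεr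
    have h2 : 0 ≤ C * (ε ^ (1 - α) / (1 - α)) := by positivity
    simp only at h1
    linarith
  have h1 := key 1 (by simp)
  have h2 := key (-1) (by simp)
  rw [abs_le]
  constructor <;> linarith [le_abs_self (h r), neg_abs_le (h r)]

section Hoelder

variable {X : Type*} [MeasurableSpace X] {μ : Measure X}

/-- The Hölder inequality for the integral of `|f|` over a subset of finite measure. -/
lemma setIntegral_abs_le_rpow_mul_rpow {f : X → ℝ} {p : ℝ} (hp : 1 < p) {S K : Set X}
    (hSK : S ⊆ K) (hS : μ S ≠ ⊤)
    (hf : IntegrableOn f K μ) (hfp : IntegrableOn (fun x => |f x| ^ p) K μ) :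
    ∫ x in S, |f x| ∂μ ≤ (∫ x in K, |f x| ^ p ∂μ) ^ (1 / p) * μ.real S ^ (1 - 1 / p) := by
  have hp0 : 0 < p := by linarith
  have hpq := Real.HolderConjugate.conjExponent hp
  have : IsFiniteMeasure (μ.restrict S) := ⟨by simpa using hS.lt_top⟩
  have hfS : IntegrableOn f S μ := hf.mono_set hSK
  have hfpS : IntegrableOn (fun x => |f x| ^ p) S μ := hfp.mono_set hSK
  have hmem : MemLp (fun x => |f x|) (ENNReal.ofReal p) (μ.restrict S) := by
    rw [← integrable_norm_rpow_iff hfS.abs.aestronglyMeasurable (by simpa using hp0) (by simp)]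
    rw [ENNReal.toReal_ofReal hp0.le]
    simpa [IntegrableOn] using hfpS
  have h := integral_mul_le_Lp_mul_Lq_of_nonneg (μ := μ.restrict S) hpq
    (f := fun x => |f x|) (g := fun _ => 1)
    (Eventually.of_forall fun _ => abs_nonneg _) (Eventually.of_forall fun _ => zero_le_one)
    hmem (memLp_const _)
  simp only [mul_one, Real.one_rpow, integral_const, smul_eq_mul, measureReal_restrict_apply_univ]
    at h
  have e : 1 / p.conjExponent = 1 - 1 / p := by
    have := hpq.inv_add_inv_eq_one
    rw [one_div, one_div]; linarith
  rw [e] at h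
  refine h.trans ?_
  gcongr
  · exact Eventually.of_forall fun x => by positivity

end Hoelder

section Kernel

variable {n : ℕ}

local notation "𝔼" => EuclideanSpace ℝ (Fin n)

lemma one_lt_normSq_div_sq {x y : 𝔼} {t : ℝ} (ht : 0 < t) (hy : y ∉ closedBall x t) :
    1 < ‖y - x‖ ^ 2 / t ^ 2 := by
  rw [mem_closedBall, dist_eq_norm, not_le] at hy
  rw [one_lt_div (by positivity)]
  gcongr

lemma contDiff_comp_normSq {G : ℝ → ℝ} {m : WithTop ℕ∞} (hG : ContDiff ℝ m G) (x : 𝔼) (t : ℝ) :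
    ContDiff ℝ m fun y : 𝔼 => G (‖y - x‖ ^ 2 / t ^ 2) := by
  refine hG.comp ?_
  simp only [div_eq_mul_inv]
  exact ((contDiff_id.sub contDiff_const).norm_sq ℝ).mul contDiff_const

lemma fderiv_comp_normSq_apply {G : ℝ → ℝ} (hG : Differentiable ℝ G) (x y v : 𝔼) (t : ℝ) :
    fderiv ℝ (fun y : 𝔼 => G (‖y - x‖ ^ 2 / t ^ 2)) y v =
      deriv G (‖y - x‖ ^ 2 / t ^ 2) * (2 * inner ℝ (y - x) v / t ^ 2) := by
  have h1 : HasFDerivAt (fun y : 𝔼 => ‖y - x‖ ^ 2) ((2 : ℝ) • innerSL ℝ (y - x)) y := by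
    have := ((hasFDerivAt_id y).sub_const x).norm_sq
    rw [two_smul, ← two_smul ℝ] at this
    exact this
  have h2 := (hG (‖y - x‖ ^ 2 / t ^ 2)).hasDerivAt.comp_hasFDerivAt y
    (h1.mul_const ((t ^ 2)⁻¹))
  have h3 : (fun y : 𝔼 => G (‖y - x‖ ^ 2 / t ^ 2)) = G ∘ fun y : 𝔼 => ‖y - x‖ ^ 2 * (t ^ 2)⁻¹ := by
    ext y; simp [div_eq_mul_inv]
  rw [h3, h2.fderiv]
  simp only [smul_apply, innerSL_apply_apply, smul_eq_mul]
  ring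

lemma contDiff_one_deriv_of_contDiff_two {H : ℝ → ℝ} (hH : ContDiff ℝ 2 H) :
    ContDiff ℝ 1 (deriv H) := by
  rw [show (2 : WithTop ℕ∞) = 1 + 1 by norm_num] at hH
  exact (contDiff_succ_iff_deriv.1 hH).2.2

lemma lap_comp_normSq {H : ℝ → ℝ} (hH : ContDiff ℝ 2 H) (x y : 𝔼) (t : ℝ) :
    lap (fun y : 𝔼 => H (‖y - x‖ ^ 2 / t ^ 2)) y =
      (2 * n * deriv H (‖y - x‖ ^ 2 / t ^ 2) +
        4 * (‖y - x‖ ^ 2 / t ^ 2) * deriv (deriv H) (‖y - x‖ ^ 2 / t ^ 2)) / t ^ 2 := by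
  have hH1 : Differentiable ℝ H := hH.differentiable (by norm_num)
  have hH' : ContDiff ℝ 1 (deriv H) := contDiff_one_deriv_of_contDiff_two hH
  have hH2 : Differentiable ℝ (deriv H) := hH'.differentiable (by norm_num)
  have hterm : ∀ i : Fin n, fderiv ℝ (fun y => fderiv ℝ (fun y : 𝔼 => H (‖y - x‖ ^ 2 / t ^ 2)) y
      (EuclideanSpace.single i 1)) y (EuclideanSpace.single i 1) =
      deriv (deriv H) (‖y - x‖ ^ 2 / t ^ 2) * (4 * (y - x) i ^ 2 / t ^ 4) +
        deriv H (‖y - x‖ ^ 2 / t ^ 2) * (2 / t ^ 2) := by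
    intro i
    have e1 : (fun y => fderiv ℝ (fun y : 𝔼 => H (‖y - x‖ ^ 2 / t ^ 2)) y
        (EuclideanSpace.single i 1)) =
        (fun y : 𝔼 => deriv H (‖y - x‖ ^ 2 / t ^ 2)) * fun y : 𝔼 => 2 * (y - x) i / t ^ 2 := by
      ext y
      rw [fderiv_comp_normSq_apply hH1]
      simp [EuclideanSpace.inner_single_right]
    have d1 : DifferentiableAt ℝ (fun y : 𝔼 => deriv H (‖y - x‖ ^ 2 / t ^ 2)) y :=
      (contDiff_comp_normSq hH' x t).differentiable (by norm_num) y
    have d2 : HasFDerivAt (fun y : 𝔼 => 2 * (y - x) i / t ^ 2)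
        ((2 / t ^ 2) • (EuclideanSpace.proj i : 𝔼 →L[ℝ] ℝ)) y := by
      have := (((EuclideanSpace.proj i : 𝔼 →L[ℝ] ℝ).hasFDerivAt (x := y)).sub_const
        (x i)).const_mul (2 / t ^ 2)
      refine this.congr_of_eventuallyEq (Eventually.of_forall fun z => ?_)
      simp; ring
    rw [e1, fderiv_mul d1 d2.differentiableAt, d2.fderiv]
    simp only [add_apply, smul_apply, smul_eq_mul,
      fderiv_comp_normSq_apply hH2, EuclideanSpace.inner_single_right]
    simp
    ring
  have hsum : ∑ i : Fin n, (y - x) i ^ 2 = ‖y - x‖ ^ 2 := by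
    rw [EuclideanSpace.real_norm_sq_eq]
  unfold lap
  rw [Finset.sum_congr rfl fun i _ => hterm i, Finset.sum_add_distrib, ← Finset.mul_sum,
    ← Finset.sum_div, ← Finset.mul_sum, hsum]
  simp
  ring

lemma exists_lipschitz_comp_normSq {G : ℝ → ℝ} (hG : ContDiff ℝ 1 G)
    (hG0 : ∀ s, 1 < s → G s = 0) : ∃ M : ℝ, 0 ≤ M ∧ ∀ (t : ℝ), 0 < t → ∀ x x' y : 𝔼,
      |G (‖y - x‖ ^ 2 / t ^ 2) - G (‖y - x'‖ ^ 2 / t ^ 2)| ≤ M / t * ‖x - x'‖ := by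
  have hc : ContDiff ℝ 1 fun z : 𝔼 => G (‖z‖ ^ 2) := hG.comp (contDiff_id.norm_sq ℝ)
  have hs : HasCompactSupport fun z : 𝔼 => G (‖z‖ ^ 2) := by
    refine HasCompactSupport.intro (isCompact_closedBall (0 : 𝔼) 1) fun z hz => hG0 _ ?_
    simpa using one_lt_normSq_div_sq one_pos hz
  obtain ⟨M, hM⟩ := hc.lipschitzWith_of_hasCompactSupport hs (by norm_num)
  refine ⟨M, M.2, fun t ht x x' y => ?_⟩
  have e : ∀ x : 𝔼, ‖y - x‖ ^ 2 / t ^ 2 = ‖t⁻¹ • (y - x)‖ ^ 2 := by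
    intro x
    rw [norm_smul, norm_inv, Real.norm_of_nonneg ht.le]
    field_simp
  rw [e, e]
  have := hM.dist_le_mul (t⁻¹ • (y - x)) (t⁻¹ • (y - x'))
  have e' : dist (t⁻¹ • (y - x)) (t⁻¹ • (y - x')) = t⁻¹ * ‖x - x'‖ := by
    rw [dist_eq_norm, ← smul_sub, norm_smul, norm_inv, Real.norm_of_nonneg ht.le,
      sub_sub_sub_cancel_left, norm_sub_rev x' x]
  rw [Real.dist_eq, e', ← mul_assoc, ← div_eq_mul_inv] at this
  exact this

end Kernel

section RadialMeans

variable {n : ℕ}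

local notation "𝔼" => EuclideanSpace ℝ (Fin n)

lemma integrable_mul_comp_normSq {G : ℝ → ℝ} (hG : Continuous G) (hG0 : ∀ s, 1 < s → G s = 0)
    {w : 𝔼 → ℝ} {x : 𝔼} {t : ℝ} (ht : 0 < t) (hw : IntegrableOn w (closedBall x t)) :
    Integrable fun y => w y * G (‖y - x‖ ^ 2 / t ^ 2) := by
  have hc : Continuous fun y : 𝔼 => G (‖y - x‖ ^ 2 / t ^ 2) :=
    hG.comp (((continuous_id.sub continuous_const).norm.pow 2).div_const _)
  rw [← integrableOn_iff_integrable_of_support_subset (s := closedBall x t)]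
  · exact hw.mul_continuousOn hc.continuousOn (isCompact_closedBall x t)
  · intro y hy
    by_contra h
    exact hy (by simp [hG0 _ (one_lt_normSq_div_sq ht h)])

lemma abs_integral_mul_sub_le {G : ℝ → ℝ} (hG : Continuous G) (hG0 : ∀ s, 1 < s → G s = 0)
    {M : ℝ} {w : 𝔼 → ℝ} {x x' : 𝔼} {t : ℝ} (ht : 0 < t)
    (hM : ∀ y : 𝔼, |G (‖y - x‖ ^ 2 / t ^ 2) - G (‖y - x'‖ ^ 2 / t ^ 2)| ≤ M / t * ‖x - x'‖)
    (hw : IntegrableOn w (closedBall x t ∪ closedBall x' t)) :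
    |(∫ y, w y * G (‖y - x‖ ^ 2 / t ^ 2)) - ∫ y, w y * G (‖y - x'‖ ^ 2 / t ^ 2)| ≤
      M / t * ‖x - x'‖ * ∫ y in closedBall x t ∪ closedBall x' t, |w y| := by
  rw [← integral_sub (integrable_mul_comp_normSq hG hG0 ht (hw.mono_set subset_union_left))
    (integrable_mul_comp_normSq hG hG0 ht (hw.mono_set subset_union_right)),
    ← setIntegral_eq_integral_of_forall_compl_eq_zero (s := closedBall x t ∪ closedBall x' t),
    ← integral_const_mul, ← Real.norm_eq_abs]
  · refine norm_integral_le_of_norm_le (hw.abs.const_mul _) (Eventually.of_forall fun y => ?_)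
    rw [← mul_sub, norm_mul, Real.norm_eq_abs, Real.norm_eq_abs, mul_comm]
    gcongr
    exact hM y
  · intro y hy
    rw [mem_union, not_or] at hy
    simp [hG0 _ (one_lt_normSq_div_sq ht hy.1), hG0 _ (one_lt_normSq_div_sq ht hy.2)]

lemma hasDerivAt_inv_pow_mul_comp_div_sq {W : ℝ → ℝ} (hW : Differentiable ℝ W) (n : ℕ) (a : ℝ)
    {t : ℝ} (ht : 0 < t) :
    HasDerivAt (fun t : ℝ => (t ^ n)⁻¹ * W (a / t ^ 2))
      (-((t ^ (n + 1))⁻¹ * (n * W (a / t ^ 2) + 2 * (a / t ^ 2) * deriv W (a / t ^ 2)))) t := by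
  have h1 : HasDerivAt (fun t : ℝ => (t ^ n)⁻¹) (-(n * (t ^ (n + 1))⁻¹)) t := by
    refine ((hasDerivAt_pow n t).fun_inv (pow_ne_zero n ht.ne')).congr_deriv ?_
    rcases n with _ | k
    · simp
    · simp only [Nat.add_sub_cancel]
      field_simp
      ring
  have h2 : HasDerivAt (fun t : ℝ => a / t ^ 2) (-(2 * a / t ^ 3)) t := by
    have := ((hasDerivAt_pow 2 t).fun_inv (pow_ne_zero 2 ht.ne')).const_mul a
    simp only [← div_eq_mul_inv] at this
    refine this.congr_deriv ?_
    field_simp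
    norm_num
    ring
  refine (h1.mul ((hW (a / t ^ 2)).hasDerivAt.comp t h2)).congr_deriv ?_
  simp only [Function.comp]
  field_simp
  ring

/-- The normalised radial means `t⁻ⁿ ∫ u(y) W(|y - x|² / t²) dy` are differentiable in `t`. -/
lemma hasDerivAt_radialMean {W : ℝ → ℝ} (hW : ContDiff ℝ 1 W) (hW0 : ∀ s, 1 < s → W s = 0)
    {u : 𝔼 → ℝ} {x : 𝔼} {t T : ℝ} (ht : 0 < t) (htT : t < T)
    (hu : IntegrableOn u (closedBall x T)) :
    HasDerivAt (fun t : ℝ => (t ^ n)⁻¹ * ∫ y, u y * W (‖y - x‖ ^ 2 / t ^ 2))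
      (-((t ^ (n + 1))⁻¹ * ∫ y, u y * (n * W (‖y - x‖ ^ 2 / t ^ 2) +
        2 * (‖y - x‖ ^ 2 / t ^ 2) * deriv W (‖y - x‖ ^ 2 / t ^ 2)))) t := by
  set S : ℝ → ℝ := fun s => n * W s + 2 * s * deriv W s with hS
  have hSc : Continuous S := by
    have := hW.continuous
    have := hW.continuous_deriv_one
    fun_prop
  have hS0 : ∀ s, 1 < s → S s = 0 := fun s hs => by
    simp [hS, hW0 s hs, deriv_eq_zero_of_one_lt hW0 hs]
  obtain ⟨M, hM0, hM⟩ := exists_bound_of_eq_zero_of_one_lt hSc hS0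
  have hint : ∀ {G : ℝ → ℝ}, Continuous G → (∀ s, 1 < s → G s = 0) → ∀ s ∈ Ioo (t / 2) T,
      Integrable fun y => u y * G (‖y - x‖ ^ 2 / s ^ 2) := fun hG hG0 s hs =>
    integrable_mul_comp_normSq hG hG0 (by linarith [hs.1])
      (hu.mono_set (closedBall_subset_closedBall hs.2.le))
  have htmem : t ∈ Ioo (t / 2) T := ⟨by linarith, htT⟩
  have key := hasDerivAt_integral_of_dominated_loc_of_deriv_le (μ := volume) (x₀ := t)
    (s := Ioo (t / 2) T)
    (F := fun s y => u y * ((s ^ n)⁻¹ * W (‖y - x‖ ^ 2 / s ^ 2)))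
    (F' := fun s y => u y * (-((s ^ (n + 1))⁻¹ * S (‖y - x‖ ^ 2 / s ^ 2))))
    (bound := (closedBall x T).indicator fun y => |u y| * (((t / 2) ^ (n + 1))⁻¹ * M))
    (Ioo_mem_nhds htmem.1 htmem.2) ?_ ?_ ?_ ?_ ?_ ?_
  · have e : (fun s : ℝ => (s ^ n)⁻¹ * ∫ y, u y * W (‖y - x‖ ^ 2 / s ^ 2)) =
        fun s => ∫ y, u y * ((s ^ n)⁻¹ * W (‖y - x‖ ^ 2 / s ^ 2)) := by
      ext s
      rw [← integral_const_mul]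
      congr 1; ext y; ring
    rw [e]
    refine key.2.congr_deriv ?_
    rw [← integral_const_mul, ← integral_neg]
    congr 1; ext y; ring
  · filter_upwards [Ioo_mem_nhds htmem.1 htmem.2] with s hs
    refine ((hint hW.continuous hW0 s hs).const_mul (s ^ n)⁻¹).aestronglyMeasurable.congr
      (Eventually.of_forall fun y => ?_)
    simp only
    ring
  · refine ((hint hW.continuous hW0 t htmem).const_mul (t ^ n)⁻¹).congr
      (Eventually.of_forall fun y => ?_)
    simp only
    ring
  · refine ((hint hSc hS0 t htmem).const_mul
      (-(t ^ (n + 1))⁻¹)).aestronglyMeasurable.congr (Eventually.of_forall fun y => ?_)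
    simp only
    ring
  · refine Eventually.of_forall fun y s hs => ?_
    have hs0 : 0 < s := by linarith [hs.1]
    by_cases hy : y ∈ closedBall x T
    · rw [indicator_of_mem hy, norm_mul, norm_neg, norm_mul, norm_inv, norm_pow,
        Real.norm_of_nonneg hs0.le, Real.norm_eq_abs, Real.norm_eq_abs]
      gcongr
      · exact hs.1.le
      · exact hM _ (by positivity)
    · rw [indicator_of_notMem hy, hS0 _ (one_lt_normSq_div_sq hs0
        fun h => hy (closedBall_subset_closedBall hs.2.le h))]
      simp
  · rw [integrable_indicator_iff measurableSet_closedBall]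
    exact hu.abs.mul_const _
  · refine Eventually.of_forall fun y s hs => ?_
    exact (hasDerivAt_inv_pow_mul_comp_div_sq (hW.differentiable (by norm_num)) n
      (‖y - x‖ ^ 2) (by linarith [hs.1])).const_mul (u y)

/-- If `Δu = f` in the sense of distributions, the radial means of `u` with profile `deriv H` have
derivative `-(t / 2) t⁻ⁿ ∫ f(y) H(|y - x|² / t²) dy`. -/
lemma hasDerivAt_radialMean_of_poisson {H : ℝ → ℝ} (hH : ContDiff ℝ (⊤ : ℕ∞) H)
    (hH0 : ∀ s, 1 < s → H s = 0) {Ω : Set 𝔼} {u f : 𝔼 → ℝ}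
    (hsol : ∀ φ : 𝔼 → ℝ, ContDiff ℝ (⊤ : ℕ∞) φ → HasCompactSupport φ → tsupport φ ⊆ Ω →
      ∫ x in Ω, u x * lap φ x = ∫ x in Ω, f x * φ x)
    {x : 𝔼} {t T : ℝ} (ht : 0 < t) (htT : t < T) (hT : closedBall x T ⊆ Ω)
    (hu : IntegrableOn u (closedBall x T)) :
    HasDerivAt (fun t : ℝ => (t ^ n)⁻¹ * ∫ y, u y * deriv H (‖y - x‖ ^ 2 / t ^ 2))
      (-(t / 2 * (t ^ n)⁻¹ * ∫ y, f y * H (‖y - x‖ ^ 2 / t ^ 2))) t := by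
  have hH2 : ContDiff ℝ 2 H := contDiff_infty.1 hH 2
  have hH' : ContDiff ℝ 1 (deriv H) := contDiff_one_deriv_of_contDiff_two hH2
  have hH'0 : ∀ s, 1 < s → deriv H s = 0 := fun s => deriv_eq_zero_of_one_lt hH0
  have hd := hasDerivAt_radialMean hH' hH'0 ht htT hu
  have hball : closedBall x t ⊆ Ω := (closedBall_subset_closedBall htT.le).trans hT
  have hout : ∀ y, y ∉ Ω → 1 < ‖y - x‖ ^ 2 / t ^ 2 := fun y hy =>
    one_lt_normSq_div_sq ht fun h => hy (hball h)
  have hsupp : Function.support (fun y : 𝔼 => H (‖y - x‖ ^ 2 / t ^ 2)) ⊆ closedBall x t := by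
    intro y hy
    by_contra h
    exact hy (hH0 _ (one_lt_normSq_div_sq ht h))
  have hsol' := hsol (fun y => H (‖y - x‖ ^ 2 / t ^ 2)) (contDiff_comp_normSq hH x t)
    (HasCompactSupport.of_support_subset_isCompact (isCompact_closedBall x t) hsupp)
    ((closure_minimal hsupp isClosed_closedBall).trans hball)
  rw [setIntegral_eq_integral_of_forall_compl_eq_zero (s := Ω)
      (f := fun y => f y * H (‖y - x‖ ^ 2 / t ^ 2))
      (fun y hy => by simp [hH0 _ (hout y hy)])] at hsol'
  simp only [lap_comp_normSq hH2] at hsol'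
  rw [setIntegral_eq_integral_of_forall_compl_eq_zero (s := Ω)
      (fun y hy => by
        rw [hH'0 _ (hout y hy), deriv_eq_zero_of_one_lt hH'0 (hout y hy)]; simp)] at hsol'
  refine hd.congr_deriv ?_
  rw [← hsol', ← integral_const_mul, ← integral_const_mul]
  congr 2
  ext y
  field_simp
  ring

/-- Radial means converge almost everywhere to a multiple of the function. -/
lemma ae_tendsto_radialMean {W : ℝ → ℝ} (hW : Continuous W) (hW0 : ∀ s, 1 < s → W s = 0)
    {u : 𝔼 → ℝ} {x₀ : 𝔼} {T : ℝ} (hu : IntegrableOn u (closedBall x₀ T)) :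
    ∀ᵐ x : 𝔼, x ∈ ball x₀ T →
      Tendsto (fun t : ℝ => (t ^ n)⁻¹ * ∫ y, u y * W (‖y - x‖ ^ 2 / t ^ 2)) (𝓝[>] 0)
        (𝓝 ((∫ z : 𝔼, W (‖z‖ ^ 2)) * u x)) := by
  obtain ⟨M, hM0, hM⟩ := exists_bound_of_eq_zero_of_one_lt hW hW0
  have hU : Integrable ((closedBall x₀ T).indicator u) :=
    hu.integrable_indicator measurableSet_closedBall
  filter_upwards [IsUnifLocDoublingMeasure.ae_tendsto_average_norm_sub volume
    hU.locallyIntegrable 1] with x hx hxT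
  have hlim := hx (l := 𝓝[>] (0 : ℝ)) (fun _ => x) (fun t => t) tendsto_id
    (by filter_upwards [self_mem_nhdsWithin] with t ht
        simpa using le_of_lt ht)
  set v : ℝ := volume.real (closedBall (0 : 𝔼) 1)
  rw [← tendsto_sub_nhds_zero_iff]
  refine squeeze_zero_norm' ?_ (by simpa using hlim.const_mul (M * v))
  have hsmall : ∀ᶠ t in 𝓝[>] (0 : ℝ), t < T - dist x x₀ :=
    mem_nhdsWithin_of_mem_nhds (Iio_mem_nhds (by rw [mem_ball] at hxT; linarith))
  filter_upwards [self_mem_nhdsWithin, hsmall] with t ht htT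
  have ht0 : 0 < t := ht
  have hsub : closedBall x t ⊆ closedBall x₀ T := closedBall_subset_closedBall' (by linarith)
  have hxmem : x ∈ closedBall x₀ T := ball_subset_closedBall hxT
  have hc : (t ^ n)⁻¹ * ∫ y : 𝔼, W (‖y - x‖ ^ 2 / t ^ 2) = ∫ z : 𝔼, W (‖z‖ ^ 2) := by
    rw [integral_sub_right_eq_self (μ := volume) (fun y : 𝔼 => W (‖y‖ ^ 2 / t ^ 2)) x]
    have e : (fun y : 𝔼 => W (‖y‖ ^ 2 / t ^ 2)) = fun y : 𝔼 => W (‖t⁻¹ • y‖ ^ 2) := by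
      ext y
      rw [norm_smul, norm_inv, Real.norm_of_nonneg ht0.le]
      congr 1; field_simp
    rw [e, Measure.integral_comp_inv_smul_of_nonneg volume (fun z : 𝔼 => W (‖z‖ ^ 2)) ht0.le,
      finrank_euclideanSpace_fin, smul_eq_mul, ← mul_assoc,
      inv_mul_cancel₀ (pow_pos ht0 n).ne', one_mul]
  have hi1 := integrable_mul_comp_normSq hW hW0 ht0 (hu.mono_set hsub)
  have hi2 := integrable_mul_comp_normSq (w := fun _ => u x) hW hW0 ht0
    (integrableOn_const (measure_closedBall_lt_top (x := x) (r := t)).ne)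
  have e : (t ^ n)⁻¹ * (∫ y, u y * W (‖y - x‖ ^ 2 / t ^ 2)) - (∫ z : 𝔼, W (‖z‖ ^ 2)) * u x =
      (t ^ n)⁻¹ * ∫ y in closedBall x t, ((closedBall x₀ T).indicator u y -
        (closedBall x₀ T).indicator u x) * W (‖y - x‖ ^ 2 / t ^ 2) := by
    rw [← hc, mul_assoc, mul_comm _ (u x), ← integral_const_mul (u x), ← mul_sub,
      ← integral_sub hi1 hi2, ← setIntegral_eq_integral_of_forall_compl_eq_zero
        (s := closedBall x t)]
    · congr 1
      refine setIntegral_congr_fun measurableSet_closedBall fun y hy => ?_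
      simp only [indicator_of_mem (hsub hy), indicator_of_mem hxmem]
      ring
    · intro y hy
      simp [hW0 _ (one_lt_normSq_div_sq ht0 hy)]
  rw [e, norm_mul, norm_inv, norm_pow, Real.norm_of_nonneg ht0.le, setAverage_eq, smul_eq_mul,
    Measure.addHaar_real_closedBall' volume x ht0.le, finrank_euclideanSpace_fin]
  have hv : 0 < v := ENNReal.toReal_pos (measure_closedBall_pos volume _ one_pos).ne'
    measure_closedBall_lt_top.ne
  have hI : ‖∫ y in closedBall x t, ((closedBall x₀ T).indicator u y -
        (closedBall x₀ T).indicator u x) * W (‖y - x‖ ^ 2 / t ^ 2)‖ ≤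
      ∫ y in closedBall x t, M * ‖(closedBall x₀ T).indicator u y -
        (closedBall x₀ T).indicator u x‖ := by
    refine norm_integral_le_of_norm_le ?_ (Eventually.of_forall fun y => ?_)
    · refine (Integrable.norm ?_).const_mul M
      exact hU.integrableOn.sub (integrableOn_const measure_closedBall_lt_top.ne)
    · rw [norm_mul, mul_comm]
      gcongr
      exact hM _ (by positivity)
  rw [integral_const_mul] at hI
  calc _ ≤ (t ^ n)⁻¹ * (M * ∫ y in closedBall x t, ‖(closedBall x₀ T).indicator u y -
        (closedBall x₀ T).indicator u x‖) := by gcongr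
    _ = _ := by
      simp only [Real.norm_eq_abs]
      change _ = M * v * ((t ^ n * v)⁻¹ * _)
      field_simp

end RadialMeans

section LocalEstimate

variable {n : ℕ}

local notation "𝔼" => EuclideanSpace ℝ (Fin n)

lemma measureReal_union_closedBall_le (x x' : 𝔼) {t : ℝ} (ht : 0 ≤ t) :
    volume.real (closedBall x t ∪ closedBall x' t) ≤
      t ^ n * (2 * volume.real (closedBall (0 : 𝔼) 1)) := by
  refine (measureReal_union_le _ _).trans_eq ?_
  rw [Measure.addHaar_real_closedBall' volume x ht, Measure.addHaar_real_closedBall' volume x' ht,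
    finrank_euclideanSpace_fin]
  ring

/-- The radial means of a solution of `Δu = f` are Lipschitz in the centre, uniformly in the
radius. -/
lemma exists_lipschitz_radialMean {H : ℝ → ℝ} (hH : ContDiff ℝ (⊤ : ℕ∞) H)
    (hH0 : ∀ s, 1 < s → H s = 0) {Ω : Set 𝔼} {p : ℝ} (hp1 : 1 < p) (hp : (n : ℝ) < p)
    {u f : 𝔼 → ℝ}
    (hsol : ∀ φ : 𝔼 → ℝ, ContDiff ℝ (⊤ : ℕ∞) φ → HasCompactSupport φ → tsupport φ ⊆ Ω →
      ∫ x in Ω, u x * lap φ x = ∫ x in Ω, f x * φ x)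
    {x₀ : 𝔼} {r : ℝ} (hr : 0 < r) (hK : closedBall x₀ (3 * r) ⊆ Ω)
    (hu : IntegrableOn u (closedBall x₀ (3 * r))) (hf : IntegrableOn f (closedBall x₀ (3 * r)))
    (hfp : IntegrableOn (fun x => |f x| ^ p) (closedBall x₀ (3 * r))) :
    ∃ L : ℝ, 0 ≤ L ∧ ∀ x ∈ ball x₀ r, ∀ x' ∈ ball x₀ r, ∀ t, 0 < t → t ≤ r →
      |(t ^ n)⁻¹ * (∫ y, u y * deriv H (‖y - x‖ ^ 2 / t ^ 2)) -
        (t ^ n)⁻¹ * ∫ y, u y * deriv H (‖y - x'‖ ^ 2 / t ^ 2)| ≤ L * ‖x - x'‖ := by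
  have hH2 : ContDiff ℝ 2 H := contDiff_infty.1 hH 2
  have hH1 : ContDiff ℝ 1 H := contDiff_infty.1 hH 1
  have hH' : ContDiff ℝ 1 (deriv H) := contDiff_one_deriv_of_contDiff_two hH2
  have hH'0 : ∀ s, 1 < s → deriv H s = 0 := fun s => deriv_eq_zero_of_one_lt hH0
  obtain ⟨M, hM0, hM⟩ := exists_lipschitz_comp_normSq (n := n) hH1 hH0
  obtain ⟨M', hM'0, hM'⟩ := exists_lipschitz_comp_normSq (n := n) hH' hH'0
  have hp0 : 0 < p := by linarith
  set K : Set 𝔼 := closedBall x₀ (3 * r)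
  have hsub : ∀ x ∈ ball x₀ r, ∀ t ≤ 2 * r, closedBall x t ⊆ K := fun x hx t ht =>
    closedBall_subset_closedBall' (by rw [mem_ball] at hx; linarith)
  set A : ℝ := (∫ x in K, |f x| ^ p) ^ (1 / p) *
    (2 * volume.real (closedBall (0 : 𝔼) 1)) ^ (1 - 1 / p) with hA
  have hA0 : 0 ≤ A := by
    have : 0 ≤ ∫ x in K, |f x| ^ p := integral_nonneg fun x => by positivity
    positivity
  set α : ℝ := n / p with hα
  have hα1 : α < 1 := (div_lt_one hp0).2 hp
  have hfbound : ∀ x ∈ ball x₀ r, ∀ x' ∈ ball x₀ r, ∀ t, 0 < t → t ≤ r →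
      ∫ y in closedBall x t ∪ closedBall x' t, |f y| ≤ A * (t ^ n * t ^ (-α)) := by
    intro x hx x' hx' t ht htr
    have hS : closedBall x t ∪ closedBall x' t ⊆ K :=
      union_subset (hsub x hx t (by linarith)) (hsub x' hx' t (by linarith))
    refine (setIntegral_abs_le_rpow_mul_rpow hp1 hS
      ((measure_mono hS).trans_lt measure_closedBall_lt_top).ne hf hfp).trans ?_
    have h0 : 0 ≤ ∫ x in K, |f x| ^ p := integral_nonneg fun x => by positivity
    have h1p : 0 ≤ 1 - 1 / p := by
      rw [sub_nonneg, div_le_one hp0]; exact hp1.le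
    calc _ ≤ (∫ x in K, |f x| ^ p) ^ (1 / p) *
          (t ^ n * (2 * volume.real (closedBall (0 : 𝔼) 1))) ^ (1 - 1 / p) := by
          gcongr
          exact measureReal_union_closedBall_le x x' ht.le
      _ = _ := by
        have e : (t ^ n) ^ (1 - 1 / p) = t ^ n * t ^ (-α) := by
          rw [← Real.rpow_natCast t n, ← Real.rpow_mul ht.le, ← Real.rpow_add ht]
          congr 1
          rw [hα]; ring
        rw [Real.mul_rpow (by positivity) (by positivity), e, hA]
        ring
  set U : ℝ := ∫ y in K, |u y|
  have hU0 : 0 ≤ U := integral_nonneg fun y => abs_nonneg _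
  refine ⟨(r ^ n)⁻¹ * (M' / r * U) + M * A / 2 * (r ^ (1 - α) / (1 - α)), ?_, ?_⟩
  · have : 0 < 1 - α := by linarith
    positivity
  intro x hx x' hx' t ht htr
  have hSr : closedBall x r ∪ closedBall x' r ⊆ K :=
    union_subset (hsub x hx r (by linarith)) (hsub x' hx' r (by linarith))
  have hderiv : ∀ z ∈ ball x₀ r, ∀ s ∈ Icc t r, HasDerivAt
      (fun t : ℝ => (t ^ n)⁻¹ * ∫ y, u y * deriv H (‖y - z‖ ^ 2 / t ^ 2))
      (-(s / 2 * (s ^ n)⁻¹ * ∫ y, f y * H (‖y - z‖ ^ 2 / s ^ 2))) s := fun z hz s hs =>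
    hasDerivAt_radialMean_of_poisson hH hH0 hsol (T := 2 * r) (ht.trans_le hs.1)
      (by linarith [hs.2]) ((hsub z hz _ le_rfl).trans hK) (hu.mono_set (hsub z hz _ le_rfl))
  have hosc := abs_le_abs_add_of_deriv_le_rpow (C := M * A / 2 * ‖x - x'‖) hα1 (by positivity)
    ht htr (fun s hs => (hderiv x hx s hs).sub (hderiv x' hx' s hs)) (fun s hs => by
      have hs0 : 0 < s := ht.trans_le hs.1
      have h1 := abs_integral_mul_sub_le (w := f) hH1.continuous hH0 hs0
        (fun y => hM s hs0 x x' y) (hf.mono_set (union_subset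
          (hsub x hx s (by linarith [hs.2])) (hsub x' hx' s (by linarith [hs.2]))))
      have h2 := hfbound x hx x' hx' s hs0 hs.2
      have e : ∀ a b : ℝ, -(s / 2 * (s ^ n)⁻¹ * a) - -(s / 2 * (s ^ n)⁻¹ * b) =
          -(s / 2 * (s ^ n)⁻¹) * (a - b) := fun a b => by ring
      rw [e, abs_mul, abs_neg, abs_of_nonneg (by positivity)]
      calc _ ≤ s / 2 * (s ^ n)⁻¹ * (M / s * ‖x - x'‖ * (A * (s ^ n * s ^ (-α)))) := by
            gcongr
            exact h1.trans (by gcongr)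
        _ = _ := by field_simp)
  refine hosc.trans ?_
  have hr1 := abs_integral_mul_sub_le (w := u) hH'.continuous hH'0 hr
    (fun y => hM' r hr x x' y) (hu.mono_set hSr)
  have hr2 : ∫ y in closedBall x r ∪ closedBall x' r, |u y| ≤ U :=
    setIntegral_mono_set hu.abs (Eventually.of_forall fun y => abs_nonneg _) hSr.eventuallyLE
  have hr3 : |(r ^ n)⁻¹ * (∫ y, u y * deriv H (‖y - x‖ ^ 2 / r ^ 2)) -
      (r ^ n)⁻¹ * ∫ y, u y * deriv H (‖y - x'‖ ^ 2 / r ^ 2)| ≤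
      (r ^ n)⁻¹ * (M' / r * ‖x - x'‖ * U) := by
    rw [← mul_sub, abs_mul, abs_of_nonneg (by positivity)]
    gcongr
    exact hr1.trans (by gcongr)
  calc _ ≤ (r ^ n)⁻¹ * (M' / r * ‖x - x'‖ * U) +
        M * A / 2 * ‖x - x'‖ * (r ^ (1 - α) / (1 - α)) := by gcongr; exact hr3
    _ = _ := by ring

lemma integral_comp_normSq_ne_zero {W : ℝ → ℝ} (hW : Continuous W) (hW0 : ∀ s, 1 < s → W s = 0)
    (hneg : ∀ s, W s ≤ 0) (hlt : W 0 < 0) : (∫ z : 𝔼, W (‖z‖ ^ 2)) ≠ 0 := by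
  have hc : Continuous fun z : 𝔼 => -W (‖z‖ ^ 2) := (hW.comp (continuous_norm.pow 2)).neg
  have hs : HasCompactSupport fun z : 𝔼 => -W (‖z‖ ^ 2) := by
    refine HasCompactSupport.intro (isCompact_closedBall (0 : 𝔼) 1) fun z hz => ?_
    simpa using hW0 _ (by simpa using one_lt_normSq_div_sq one_pos hz)
  have h := hc.integral_pos_of_hasCompactSupport_nonneg_nonzero (μ := volume) hs
    (fun z => by simpa using hneg _) (x := 0) (by simpa using hlt.ne)
  rw [integral_neg] at h
  linarith

end LocalEstimate

/-- A function which is Lipschitz on `G ∩ ball x₀ r` for a relatively dense set `G` extends from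
`G` to a Lipschitz function on `ball x₀ r`. -/
lemma lipschitzOnWith_extendFrom {X : Type*} [PseudoMetricSpace X] {G : Set X} {u : X → ℝ}
    {x₀ : X} {r : ℝ} {L : NNReal} (hdense : ball x₀ r ⊆ closure G)
    (hL : LipschitzOnWith L u (G ∩ ball x₀ r)) :
    LipschitzOnWith L (extendFrom G u) (ball x₀ r) ∧
      EqOn (extendFrom G u) u (G ∩ ball x₀ r) := by
  obtain ⟨w, hw, hwu⟩ := hL.extend_real
  have h : EqOn (extendFrom G u) w (ball x₀ r) := by
    intro x hx
    refine extendFrom_eq (hdense hx) ?_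
    refine (hw.continuous.continuousWithinAt (s := G) (x := x)).tendsto.congr' ?_
    filter_upwards [self_mem_nhdsWithin, mem_nhdsWithin_of_mem_nhds (isOpen_ball.mem_nhds hx)]
      with y hyG hyB using (hwu ⟨hyG, hyB⟩).symm
  refine ⟨fun x hx y hy => ?_, fun x hx => (h hx.2).trans (hwu hx).symm⟩
  rw [h hx, h hy]
  exact hw x y

/-- Euclidean case of Theorem 1.2: a distributional solution of `Δu = f` on an open
set `Ω ⊆ ℝⁿ` with `f ∈ L^p_loc(Ω)`, `p > n`, has a locally Lipschitz representative. -/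
theorem poisson_locally_lipschitz_representative
    (n : ℕ) (hn : 1 ≤ n) (Ω : Set (EuclideanSpace ℝ (Fin n))) (hΩ : IsOpen Ω)
    (p : ℝ) (hp : (n : ℝ) < p)
    (u f : EuclideanSpace ℝ (Fin n) → ℝ)
    (hu : LocallyIntegrableOn u Ω)
    (hf : LocallyIntegrableOn f Ω)
    (hfp : ∀ K : Set (EuclideanSpace ℝ (Fin n)), K ⊆ Ω → IsCompact K →
      IntegrableOn (fun x => |f x| ^ p) K)
    (hsol : ∀ φ : EuclideanSpace ℝ (Fin n) → ℝ, ContDiff ℝ (⊤ : ℕ∞) φ →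
      HasCompactSupport φ → tsupport φ ⊆ Ω →
      ∫ x in Ω, u x * lap φ x = ∫ x in Ω, f x * φ x) :
    ∃ v : EuclideanSpace ℝ (Fin n) → ℝ,
      (∀ x ∈ Ω, ∃ K : NNReal, ∃ ε > 0, ball x ε ⊆ Ω ∧ LipschitzOnWith K v (ball x ε)) ∧
      ∀ᵐ x ∂(volume.restrict Ω), u x = v x := by
  obtain ⟨H, hH, hH0, hneg, hlt⟩ := exists_smooth_decreasing_profile
  have hp1 : 1 < p := lt_of_le_of_lt (by exact_mod_cast hn) hp
  have hH' : Continuous (deriv H) :=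
    (contDiff_one_deriv_of_contDiff_two (contDiff_infty.1 hH 2)).continuous
  have hH'0 : ∀ s, 1 < s → deriv H s = 0 := fun s => deriv_eq_zero_of_one_lt hH0
  set c : ℝ := ∫ z : EuclideanSpace ℝ (Fin n), deriv H (‖z‖ ^ 2)
  have hc : c ≠ 0 := integral_comp_normSq_ne_zero hH' hH'0 hneg (hlt 0 one_pos)
  set G : Set (EuclideanSpace ℝ (Fin n)) := {x | x ∈ Ω ∧
    Tendsto (fun t : ℝ => (t ^ n)⁻¹ * ∫ y, u y * deriv H (‖y - x‖ ^ 2 / t ^ 2)) (𝓝[>] 0)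
      (𝓝 (c * u x))}
  have hball : ∀ x ∈ Ω, ∃ r > 0, closedBall x (3 * r) ⊆ Ω := by
    intro x hx
    obtain ⟨ε, hε, h⟩ := Metric.nhds_basis_closedBall.mem_iff.1 (hΩ.mem_nhds hx)
    exact ⟨ε / 3, by positivity, by rwa [mul_div_cancel₀ _ (by norm_num : (3 : ℝ) ≠ 0)]⟩
  have hnull : volume (Ω \ G) = 0 := by
    refine measure_null_of_locally_null _ fun x hx => ?_
    obtain ⟨r, hr, hK⟩ := hball x hx.1
    refine ⟨(Ω \ G) ∩ ball x (3 * r), Filter.inter_mem self_mem_nhdsWithin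
      (mem_nhdsWithin_of_mem_nhds (ball_mem_nhds x (by positivity))), ?_⟩
    have h := ae_tendsto_radialMean hH' hH'0
      (hu.integrableOn_compact_subset hK (isCompact_closedBall x (3 * r)))
    refine measure_mono_null ?_ (ae_iff.1 h)
    rintro y ⟨⟨hyΩ, hyG⟩, hyB⟩ hy
    exact hyG ⟨hyΩ, hy hyB⟩
  have hdense : Ω ⊆ closure G := by
    intro x hx
    rw [_root_.mem_closure_iff]
    intro V hV hxV
    by_contra hne
    have hsub : V ∩ Ω ⊆ Ω \ G := fun y hy => ⟨hy.2, fun hyG => hne ⟨y, hy.1, hyG⟩⟩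
    exact ((hV.inter hΩ).measure_pos volume ⟨x, hxV, hx⟩).ne' (measure_mono_null hsub hnull)
  have hlocal : ∀ x₀ ∈ Ω, ∃ r > 0, ball x₀ r ⊆ Ω ∧
      ∃ L : NNReal, LipschitzOnWith L u (G ∩ ball x₀ r) := by
    intro x₀ hx₀
    obtain ⟨r, hr, hK⟩ := hball x₀ hx₀
    have hcpt := isCompact_closedBall x₀ (3 * r)
    obtain ⟨L, hL0, hL⟩ := exists_lipschitz_radialMean hH hH0 hp1 hp hsol hr hK
      (hu.integrableOn_compact_subset hK hcpt) (hf.integrableOn_compact_subset hK hcpt)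
      (hfp _ hK hcpt)
    refine ⟨r, hr, (ball_subset_closedBall.trans
      (closedBall_subset_closedBall (by linarith))).trans hK, (L / |c|).toNNReal,
      LipschitzOnWith.of_dist_le_mul fun x hx y hy => ?_⟩
    rw [Real.coe_toNNReal _ (by positivity), Real.dist_eq, dist_eq_norm]
    have hlim := (hx.1.2.sub hy.1.2).abs
    have hle := le_of_tendsto hlim (b := L * ‖x - y‖) (by
      filter_upwards [self_mem_nhdsWithin, mem_nhdsWithin_of_mem_nhds (Iic_mem_nhds hr)]
        with t ht htr using hL x hx.2 y hy.2 t ht htr)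
    rw [← mul_sub, abs_mul] at hle
    rw [div_mul_eq_mul_div, le_div_iff₀ (abs_pos.2 hc)]
    linarith
  refine ⟨extendFrom G u, fun x hx => ?_, ?_⟩
  · obtain ⟨r, hr, hB, L, hL⟩ := hlocal x hx
    exact ⟨L, r, hr, hB, (lipschitzOnWith_extendFrom (hB.trans hdense) hL).1⟩
  · rw [ae_restrict_iff' hΩ.measurableSet]
    have h : ∀ᵐ x : EuclideanSpace ℝ (Fin n), x ∉ Ω \ G := measure_eq_zero_iff_ae_notMem.1 hnull
    filter_upwards [h] with x hx hxΩ
    have hxG : x ∈ G := by_contra fun h => hx ⟨hxΩ, h⟩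
    obtain ⟨r, hr, hB, L, hL⟩ := hlocal x hxΩ
    exact ((lipschitzOnWith_extendFrom (hB.trans hdense) hL).2 ⟨hxG, mem_ball_self hr⟩).symm
end

section
/- Let n ≥ 1 and n < p < ∞. There exists a constant C, depending only on n and p, with the following property: for every x₀ ∈ ℝⁿ, every r > 0, and every function u that is twice continuously differentiable on an open set containing the closed ball of center x₀ and radius 2r and satisfies Δu = f pointwise on B(x₀,2r) with f ∈ L^p(B(x₀,2r)), one has sup_{B(x₀,r)} |u| ≤ C [ r^{−n/2} ‖u‖_{L²(B(x₀,2r))} + r^{2−n/p} ‖f‖_{L^p(B(x₀,2r))} ]. -/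
open MeasureTheory Metric Set

open Filter Topology

lemma hasDerivAt_max_zero_sq (s : ℝ) :
    HasDerivAt (fun s : ℝ => max 0 s ^ 2) (2 * max 0 s) s := by
  rcases lt_trichotomy s 0 with hs | rfl | hs
  · have h : (fun s : ℝ => max 0 s ^ 2) =ᶠ[𝓝 s] fun _ => 0 := by
      filter_upwards [Iio_mem_nhds hs] with z hz
      simp [max_eq_left (mem_Iio.1 hz).le]
    simpa [max_eq_left hs.le] using (hasDerivAt_const s (0 : ℝ)).congr_of_eventuallyEq h
  · rw [hasDerivAt_iff_isLittleO]
    refine Asymptotics.IsBigO.trans_isLittleO (g := fun z : ℝ => z ^ 2) ?_ ?_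
    · refine Asymptotics.IsBigO.of_bound 1 (Eventually.of_forall fun z => ?_)
      rcases le_total z 0 with h | h <;> simp [h, sq_nonneg]
    · simpa using Asymptotics.isLittleO_pow_id (𝕜 := ℝ) (n := 2) one_lt_two
  · have h : (fun s : ℝ => max 0 s ^ 2) =ᶠ[𝓝 s] fun z => z ^ 2 := by
      filter_upwards [Ioi_mem_nhds hs] with z hz
      simp [max_eq_right (mem_Ioi.1 hz).le]
    simpa [max_eq_right hs.le] using (hasDerivAt_pow 2 s).congr_of_eventuallyEq h

/-- The function `(1 - ‖y‖²)₊`, supported in the closed unit ball. -/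
noncomputable def capBump {n : ℕ} (y : EuclideanSpace ℝ (Fin n)) : ℝ := max 0 (1 - ‖y‖ ^ 2)

namespace capBump

variable {n : ℕ}

lemma continuous : Continuous (capBump (n := n)) := by
  unfold capBump
  fun_prop

lemma nonneg (y : EuclideanSpace ℝ (Fin n)) : 0 ≤ capBump y := le_max_left _ _

lemma eq_zero_of_notMem_ball {y : EuclideanSpace ℝ (Fin n)} (hy : y ∉ ball 0 1) :
    capBump y = 0 := by
  have : 1 ≤ ‖y‖ := by simpa using hy
  exact max_eq_left (by nlinarith)

lemma hasCompactSupport : HasCompactSupport (capBump (n := n)) :=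
  HasCompactSupport.intro (isCompact_closedBall 0 1) fun _ hy =>
    eq_zero_of_notMem_ball fun h => hy (ball_subset_closedBall h)

lemma hasFDerivAt_sq (y : EuclideanSpace ℝ (Fin n)) :
    HasFDerivAt (fun y => capBump y ^ 2) ((-4 * capBump y) • innerSL ℝ y) y := by
  have h := (hasDerivAt_max_zero_sq (1 - ‖y‖ ^ 2)).comp_hasFDerivAt y
    ((hasStrictFDerivAt_norm_sq y).hasFDerivAt.const_sub 1)
  refine h.congr_fderiv ?_
  ext v
  simp [capBump]
  ring

lemma fderiv_sq_single (y : EuclideanSpace ℝ (Fin n)) (i : Fin n) :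
    fderiv ℝ (fun y => capBump y ^ 2) y (EuclideanSpace.single i 1) = -(4 * capBump y * y i) := by
  rw [(hasFDerivAt_sq y).fderiv]
  simp [EuclideanSpace.inner_single_right]

lemma integral_pos : 0 < ∫ y, 4 * capBump (n := n) y :=
  (continuous.const_mul 4).integral_pos_of_hasCompactSupport_nonneg_nonzero
    hasCompactSupport.mul_left (fun y => mul_nonneg zero_le_four (nonneg y)) (x := 0)
    (by simp [capBump])

end capBump

/-- The Hölder inequality for the average of a dilated function against a weight
supported in the unit ball. -/
lemma abs_integral_dilate_mul_le {n : ℕ} {p q : ℝ} (hpq : p.HolderConjugate q)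
    {w ψ : EuclideanSpace ℝ (Fin n) → ℝ} (hw : Continuous w) (hψ : Continuous ψ)
    (hψ0 : ∀ y, y ∉ ball 0 1 → ψ y = 0) {x : EuclideanSpace ℝ (Fin n)} {t : ℝ} (ht : 0 < t)
    {S : Set (EuclideanSpace ℝ (Fin n))} (hS : ball x t ⊆ S)
    (hwS : IntegrableOn (fun z => |w z| ^ p) S) :
    |∫ y, w (x + t • y) * ψ y| ≤
      (∫ y in ball 0 1, |ψ y| ^ q) ^ (1 / q) * (t ^ (-(n : ℝ) / p) *
        (∫ z in S, |w z| ^ p) ^ (1 / p)) := by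
  have hmem : ∀ (g : EuclideanSpace ℝ (Fin n) → ℝ) (s : ENNReal), Continuous g →
      MemLp (fun y => |g y|) s (volume.restrict (ball 0 1)) := by
    intro g s hg
    obtain ⟨C, hC⟩ :=
      (isCompact_closedBall (0 : EuclideanSpace ℝ (Fin n)) 1).exists_bound_of_continuousOn
        hg.continuousOn
    have : IsFiniteMeasure (volume.restrict (ball (0 : EuclideanSpace ℝ (Fin n)) 1)) :=
      ⟨by simpa using measure_ball_lt_top⟩
    refine MemLp.of_bound hg.abs.aestronglyMeasurable C ?_
    filter_upwards [ae_restrict_mem measurableSet_ball] with y hy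
    simpa using hC y (ball_subset_closedBall hy)
  have hholder := integral_mul_le_Lp_mul_Lq_of_nonneg hpq
    (μ := volume.restrict (ball (0 : EuclideanSpace ℝ (Fin n)) 1))
    (Eventually.of_forall fun y => abs_nonneg (w (x + t • y)))
    (Eventually.of_forall fun y => abs_nonneg (ψ y))
    (hmem (fun y => w (x + t • y)) _ (by fun_prop)) (hmem ψ _ hψ)
  have hscale : ∫ y in ball (0 : EuclideanSpace ℝ (Fin n)) 1, |w (x + t • y)| ^ p =
      t ^ (-(n : ℝ)) * ∫ z in ball x t, |w z| ^ p := by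
    rw [Measure.setIntegral_comp_smul_of_pos volume (fun z => |w (x + z)| ^ p) _ ht,
      smul_unitBall_of_pos ht, finrank_euclideanSpace_fin, smul_eq_mul, Real.rpow_neg ht.le,
      Real.rpow_natCast]
    congr 1
    have h := (measurePreserving_add_left (volume : Measure (EuclideanSpace ℝ (Fin n))) x
      ).setIntegral_preimage_emb (measurableEmbedding_addLeft x) (fun z => |w z| ^ p) (ball x t)
    rw [← h]
    simp
  have hmono : ∫ z in ball x t, |w z| ^ p ≤ ∫ z in S, |w z| ^ p :=
    setIntegral_mono_set hwS (Eventually.of_forall fun z => Real.rpow_nonneg (abs_nonneg _) _)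
      hS.eventuallyLE
  have h0 : 0 ≤ ∫ z in ball x t, |w z| ^ p :=
    integral_nonneg fun z => Real.rpow_nonneg (abs_nonneg _) _
  have hp : 0 < p := hpq.pos
  calc |∫ y, w (x + t • y) * ψ y|
      = |∫ y in ball 0 1, w (x + t • y) * ψ y| := by
        rw [setIntegral_eq_integral_of_forall_compl_eq_zero fun y hy => by rw [hψ0 y hy, mul_zero]]
    _ ≤ ∫ y in ball 0 1, |w (x + t • y)| * |ψ y| := by
        simp only [← abs_mul]
        exact abs_integral_le_integral_abs
    _ ≤ _ := hholder
    _ ≤ (t ^ (-(n : ℝ) / p) * (∫ z in S, |w z| ^ p) ^ (1 / p)) *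
          (∫ y in ball 0 1, |ψ y| ^ q) ^ (1 / q) := by
        have hψq : 0 ≤ (∫ y in ball 0 1, |ψ y| ^ q) ^ (1 / q) :=
          Real.rpow_nonneg (integral_nonneg fun y => Real.rpow_nonneg (abs_nonneg _) _) _
        refine mul_le_mul_of_nonneg_right ?_ hψq
        rw [hscale, Real.mul_rpow (by positivity) h0, ← Real.rpow_mul ht.le, mul_one_div]
        gcongr
    _ = _ := mul_comm _ _

/-- The derivative of the weighted average `t ↦ ∫ u(x + ty) w(y) dy` with `w = 4 capBump`. -/
lemma hasDerivAt_integral_dilate_mul_capBump {n : ℕ} {u : EuclideanSpace ℝ (Fin n) → ℝ}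
    (hu : ContDiff ℝ 2 u) (x : EuclideanSpace ℝ (Fin n)) (t : ℝ) :
    HasDerivAt (fun t : ℝ => ∫ y, u (x + t • y) * (4 * capBump y))
      (t * ∫ y, lap u (x + t • y) * capBump y ^ 2) t := by
  have hc := capBump.continuous (n := n)
  have hcs := capBump.hasCompactSupport (n := n)
  have hu1 : ∀ i : Fin n, ContDiff ℝ 1 fun y => fderiv ℝ u y (EuclideanSpace.single i 1) :=
    fun i => (hu.fderiv_right (m := 1) (by norm_num)).clm_apply contDiff_const
  have hdu : Continuous (fderiv ℝ u) := hu.continuous_fderiv (by norm_num)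
  have hd1 : ∀ i : Fin n, Continuous fun y =>
      fderiv ℝ (fun z => fderiv ℝ u z (EuclideanSpace.single i 1)) y :=
    fun i => (hu1 i).continuous_fderiv (by norm_num)
  have hint : ∀ {G : EuclideanSpace ℝ (Fin n) → ℝ} (g : EuclideanSpace ℝ (Fin n) → ℝ),
      Continuous g → (∀ y, G y = g y * capBump y) → Integrable G := by
    intro G g hg hG
    rw [funext hG]
    exact (hg.mul hc).integrable_of_hasCompactSupport hcs.mul_left
  have hparts : ∀ i : Fin n,
      ∫ y, fderiv ℝ u (x + t • y) (EuclideanSpace.single i 1) * (4 * capBump y * y i) =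
        t * ∫ y, fderiv ℝ (fun z => fderiv ℝ u z (EuclideanSpace.single i 1)) (x + t • y)
          (EuclideanSpace.single i 1) * capBump y ^ 2 := by
    intro i
    have hder : ∀ y, fderiv ℝ
        (fun y => fderiv ℝ u (x + t • y) (EuclideanSpace.single i 1)) y
          (EuclideanSpace.single i 1) =
        t * fderiv ℝ (fun z => fderiv ℝ u z (EuclideanSpace.single i 1)) (x + t • y)
          (EuclideanSpace.single i 1) := by
      intro y
      have h := (((hu1 i).differentiable (by norm_num)) (x + t • y)).hasFDerivAt.comp y
        (((hasFDerivAt_id y).const_smul t).const_add x)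
      have h' := h.fderiv
      simp only [Function.comp_def, Pi.smul_apply, id] at h'
      rw [h']
      simp
    have hcont : Continuous fun y => fderiv ℝ u (x + t • y) (EuclideanSpace.single i 1) := by
      fun_prop
    have hcont' : Continuous fun y => fderiv ℝ (fun z => fderiv ℝ u z (EuclideanSpace.single i 1))
        (x + t • y) (EuclideanSpace.single i 1) := by
      have := hd1 i
      fun_prop
    have h := integral_mul_fderiv_eq_neg_fderiv_mul_of_integrable (𝕜 := ℝ)
      (μ := (volume : Measure (EuclideanSpace ℝ (Fin n))))
      (f := fun y => fderiv ℝ u (x + t • y) (EuclideanSpace.single i 1))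
      (g := fun y => capBump y ^ 2) (v := EuclideanSpace.single i 1) ?_ ?_ ?_ ?_ ?_
    · simp only [capBump.fderiv_sq_single, hder, mul_neg, integral_neg, neg_inj, mul_assoc,
        integral_const_mul] at h ⊢
      exact h
    · simp only [hder]
      exact hint (fun y => t * fderiv ℝ (fun z => fderiv ℝ u z (EuclideanSpace.single i 1))
        (x + t • y) (EuclideanSpace.single i 1) * capBump y) (by fun_prop) fun y => by ring
    · simp only [capBump.fderiv_sq_single]
      exact hint (fun y => -(fderiv ℝ u (x + t • y) (EuclideanSpace.single i 1) * (4 * y i)))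
        (by fun_prop) fun y => by ring
    · exact hint (fun y => fderiv ℝ u (x + t • y) (EuclideanSpace.single i 1) * capBump y)
        (by fun_prop) fun y => by ring
    · intro y _
      exact ((hu1 i).differentiable (by norm_num)).comp
        ((differentiable_id.const_smul t).const_add x) |>.differentiableAt
    · intro y _
      exact (capBump.hasFDerivAt_sq y).differentiableAt
  have hvalue : t * ∫ y, lap u (x + t • y) * capBump y ^ 2 =
      ∫ y, fderiv ℝ u (x + t • y) y * (4 * capBump y) := by
    have hexp : ∀ y : EuclideanSpace ℝ (Fin n), fderiv ℝ u (x + t • y) y * (4 * capBump y) =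
        ∑ i, fderiv ℝ u (x + t • y) (EuclideanSpace.single i 1) * (4 * capBump y * y i) := by
      intro y
      have hy : y = ∑ i, y i • EuclideanSpace.single i (1 : ℝ) := by
        ext j
        simp [Finset.sum_apply, Pi.single_apply]
      conv_lhs => arg 1; arg 2; rw [hy]
      rw [map_sum, Finset.sum_mul]
      refine Finset.sum_congr rfl fun i _ => ?_
      rw [map_smul, smul_eq_mul]
      ring
    simp only [hexp, lap, Finset.sum_mul]
    rw [integral_finsetSum, integral_finsetSum, Finset.mul_sum]
    · exact Finset.sum_congr rfl fun i _ => (hparts i).symm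
    · intro i _
      exact hint (fun y => fderiv ℝ u (x + t • y) (EuclideanSpace.single i 1) * (4 * y i))
        (by fun_prop) fun y => by ring
    · intro i _
      have := hd1 i
      exact hint (fun y => fderiv ℝ (fun z => fderiv ℝ u z (EuclideanSpace.single i 1))
        (x + t • y) (EuclideanSpace.single i 1) * capBump y) (by fun_prop) fun y => by ring
  rw [hvalue]
  have hcu : Continuous u := hu.continuous
  obtain ⟨C, hC⟩ := ((isCompact_closedBall t 1).prod
    (isCompact_closedBall (0 : EuclideanSpace ℝ (Fin n)) 1)).exists_bound_of_continuousOn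
    (f := fun z : ℝ × EuclideanSpace ℝ (Fin n) => fderiv ℝ u (x + z.1 • z.2) z.2)
    (by fun_prop)
  refine (hasDerivAt_integral_of_dominated_loc_of_deriv_le (s := ball t 1)
    (bound := fun y => C * (4 * capBump y))
    (F := fun s y => u (x + s • y) * (4 * capBump y))
    (F' := fun s y => fderiv ℝ u (x + s • y) y * (4 * capBump y)) (ball_mem_nhds t one_pos)
    (Eventually.of_forall fun s => Continuous.aestronglyMeasurable (by fun_prop)) ?_
    (Continuous.aestronglyMeasurable (by fun_prop)) ?_ ?_ ?_).2
  · exact hint (fun y => u (x + t • y) * 4) (by fun_prop) fun y => by ring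
  · refine Eventually.of_forall fun y s hs => ?_
    rw [norm_mul, Real.norm_of_nonneg (mul_nonneg zero_le_four (capBump.nonneg y))]
    by_cases hy : y ∈ ball 0 1
    · exact mul_le_mul_of_nonneg_right
        (hC (s, y) ⟨ball_subset_closedBall hs, ball_subset_closedBall hy⟩)
        (mul_nonneg zero_le_four (capBump.nonneg y))
    · simp [capBump.eq_zero_of_notMem_ball hy]
  · exact hint (fun _ => C * 4) continuous_const fun y => by ring
  · refine Eventually.of_forall fun y s _ => ?_
    have h := ((hu.differentiable (by norm_num)) (x + s • y)).hasFDerivAt.comp_hasDerivAt s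
      (((hasDerivAt_id s).smul_const y).const_add x)
    simpa using h.mul_const (4 * capBump y)

/-- A `C²` function near a closed ball agrees on the open ball with a global `C²` function. -/
lemma exists_contDiff_eqOn_ball {n : ℕ} {u : EuclideanSpace ℝ (Fin n) → ℝ}
    {U : Set (EuclideanSpace ℝ (Fin n))} (hU : IsOpen U) {x₀ : EuclideanSpace ℝ (Fin n)} {R : ℝ}
    (hR : 0 < R) (hsub : closedBall x₀ R ⊆ U) (hu : ContDiffOn ℝ 2 u U) :
    ∃ v : EuclideanSpace ℝ (Fin n) → ℝ, ContDiff ℝ 2 v ∧ EqOn v u (ball x₀ R) := by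
  obtain ⟨δ, hδ, hδU⟩ := (isCompact_closedBall x₀ R).exists_cthickening_subset_open hU hsub
  rw [cthickening_closedBall hδ.le hR.le] at hδU
  let χ : ContDiffBump x₀ := ⟨R, δ + R, hR, by linarith⟩
  refine ⟨fun y => χ y * u y, contDiff_iff_contDiffAt.2 fun y => ?_, fun y hy => ?_⟩
  · by_cases hy : y ∈ U
    · exact χ.contDiffAt.mul (hu.contDiffAt (hU.mem_nhds hy))
    · have hχ : χ =ᶠ[𝓝 y] 0 := by
        rw [← notMem_tsupport_iff_eventuallyEq, χ.tsupport_eq]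
        exact fun h => hy (hδU h)
      refine (contDiffAt_const (c := (0 : ℝ))).congr_of_eventuallyEq ?_
      filter_upwards [hχ] with z hz
      simp [hz]
  · simp [χ.one_of_mem_closedBall (ball_subset_closedBall hy)]

lemma lap_eq_of_eventuallyEq {n : ℕ} {u v : EuclideanSpace ℝ (Fin n) → ℝ}
    {x : EuclideanSpace ℝ (Fin n)} (h : v =ᶠ[𝓝 x] u) : lap v x = lap u x := by
  unfold lap
  refine Finset.sum_congr rfl fun i _ => ?_
  have : (fun y => fderiv ℝ v y (EuclideanSpace.single i 1)) =ᶠ[𝓝 x]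
      fun y => fderiv ℝ u y (EuclideanSpace.single i 1) := by
    filter_upwards [h.fderiv (𝕜 := ℝ)] with y hy
    rw [hy]
  rw [this.fderiv_eq]

lemma continuous_lap {n : ℕ} {u : EuclideanSpace ℝ (Fin n) → ℝ} (hu : ContDiff ℝ 2 u) :
    Continuous (lap u) := by
  unfold lap
  refine continuous_finsetSum _ fun i _ => ?_
  have h : ContDiff ℝ 1 fun y => fderiv ℝ u y (EuclideanSpace.single i 1) :=
    (hu.fderiv_right (m := 1) (by norm_num)).clm_apply contDiff_const
  exact (h.continuous_fderiv (by norm_num)).clm_apply continuous_const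

/-- Euclidean, classical-solution case of Lemma 2.1: the local sup bound
`sup_{B(x₀,r)} |u| ≤ C (r^{-n/2} ‖u‖_{L²(B(x₀,2r))} + r^{2-n/p} ‖f‖_{L^p(B(x₀,2r))})`
for classical solutions of `Δu = f` with `f ∈ L^p`, `p > n`. -/
theorem poisson_local_sup_bound
    (n : ℕ) (hn : 1 ≤ n) (p : ℝ) (hp : (n : ℝ) < p) :
    ∃ C : ℝ, 0 < C ∧
      ∀ (x₀ : EuclideanSpace ℝ (Fin n)) (r : ℝ), 0 < r →
      ∀ (u f : EuclideanSpace ℝ (Fin n) → ℝ),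
      (∃ U : Set (EuclideanSpace ℝ (Fin n)), IsOpen U ∧ closedBall x₀ (2 * r) ⊆ U ∧
        ContDiffOn ℝ 2 u U) →
      (∀ x ∈ ball x₀ (2 * r), lap u x = f x) →
      IntegrableOn (fun x => |f x| ^ p) (ball x₀ (2 * r)) →
      ∀ x ∈ ball x₀ r,
        |u x| ≤ C * (r ^ (-(n : ℝ) / 2) * (∫ z in ball x₀ (2 * r), (u z) ^ 2) ^ ((1 : ℝ) / 2)
          + r ^ (2 - (n : ℝ) / p) * (∫ z in ball x₀ (2 * r), |f z| ^ p) ^ (1 / p)) := by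
  have hn1 : (1 : ℝ) ≤ n := by exact_mod_cast hn
  have hp0 : 0 < p := by linarith
  have hpq := Real.HolderConjugate.conjExponent (p := p) (by linarith)
  have h22 : (2 : ℝ).HolderConjugate 2 := by constructor <;> norm_num
  have hnp : (n : ℝ) / p < 1 := (div_lt_one hp0).2 hp
  set q := p.conjExponent
  set c : ℝ := ∫ y : EuclideanSpace ℝ (Fin n), 4 * capBump y with hc
  have hc0 : 0 < c := capBump.integral_pos
  set K₁ : ℝ := (∫ y in ball (0 : EuclideanSpace ℝ (Fin n)) 1, |4 * capBump y| ^ (2 : ℝ)) ^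
    ((1 : ℝ) / 2)
  set K₂ : ℝ := (∫ y in ball (0 : EuclideanSpace ℝ (Fin n)) 1, |capBump y ^ 2| ^ q) ^ (1 / q)
  have hK₁0 : 0 ≤ K₁ :=
    Real.rpow_nonneg (integral_nonneg fun y => Real.rpow_nonneg (abs_nonneg _) _) _
  have hK₂0 : 0 ≤ K₂ :=
    Real.rpow_nonneg (integral_nonneg fun y => Real.rpow_nonneg (abs_nonneg _) _) _
  refine ⟨(K₁ + K₂ + 1) / c, by positivity, ?_⟩
  rintro x₀ r hr u f ⟨U, hU, hsub, hu⟩ hlap hf x hx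
  obtain ⟨v, hv, hvu⟩ := exists_contDiff_eqOn_ball hU (by positivity) hsub hu
  have hxs : ∀ t ≤ r, ball x t ⊆ ball x₀ (2 * r) := fun t ht =>
    ball_subset_ball' (by have := mem_ball.1 hx; linarith)
  have hvf : EqOn (lap v) f (ball x₀ (2 * r)) := fun y hy =>
    (lap_eq_of_eventuallyEq (hvu.eventuallyEq_of_mem (isOpen_ball.mem_nhds hy))).trans (hlap y hy)
  have hLint : IntegrableOn (fun z => |lap v z| ^ p) (ball x₀ (2 * r)) :=
    hf.congr_fun (fun z hz => by simp only [hvf hz]) measurableSet_ball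
  have hLeq : ∫ z in ball x₀ (2 * r), |lap v z| ^ p = ∫ z in ball x₀ (2 * r), |f z| ^ p :=
    setIntegral_congr_fun measurableSet_ball fun z hz => by simp only [hvf hz]
  have hVint : IntegrableOn (fun z => |v z| ^ (2 : ℝ)) (ball x₀ (2 * r)) := by
    have hcv := hv.continuous
    simp only [Real.rpow_two]
    exact ((Continuous.continuousOn (by fun_prop)).integrableOn_compact
      (isCompact_closedBall x₀ (2 * r))).mono_set ball_subset_closedBall
  have hVeq : ∫ z in ball x₀ (2 * r), |v z| ^ (2 : ℝ) = ∫ z in ball x₀ (2 * r), (u z) ^ 2 :=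
    setIntegral_congr_fun measurableSet_ball fun z hz => by
      simp only [hvu hz, Real.rpow_two, sq_abs]
  set N : ℝ := (∫ z in ball x₀ (2 * r), |f z| ^ p) ^ (1 / p)
  have hN0 : 0 ≤ N :=
    Real.rpow_nonneg (integral_nonneg fun y => Real.rpow_nonneg (abs_nonneg _) _) _
  set L : ℝ := (∫ z in ball x₀ (2 * r), (u z) ^ 2) ^ ((1 : ℝ) / 2)
  have hL0 : 0 ≤ L := Real.rpow_nonneg (integral_nonneg fun y => sq_nonneg _) _
  set M : ℝ → ℝ := fun t => ∫ y, v (x + t • y) * (4 * capBump y) with hM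
  have hM0 : M 0 = u x * c := by
    simp [hM, hc, integral_const_mul, hvu (hxs r le_rfl (mem_ball_self hr))]
  have hMr : |M r| ≤ K₁ * (r ^ (-(n : ℝ) / 2) * L) := by
    have h := abs_integral_dilate_mul_le h22 hv.continuous (capBump.continuous.const_mul 4)
      (fun y hy => by simp [capBump.eq_zero_of_notMem_ball hy]) hr (hxs r le_rfl) hVint
    rwa [hVeq] at h
  set e : ℝ := 2 - n / p with he
  have he1 : 1 ≤ e := by linarith
  have hbound : ∀ t ∈ Ico 0 r, ‖t * ∫ y, lap v (x + t • y) * capBump y ^ 2‖ ≤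
      K₂ * N * (e * t ^ (e - 1)) := by
    rintro t ⟨ht0, htr⟩
    rcases ht0.eq_or_lt with rfl | ht
    · simp only [zero_mul, norm_zero]
      positivity
    have h := abs_integral_dilate_mul_le hpq (continuous_lap hv) (capBump.continuous.pow 2)
      (fun y hy => by simp [capBump.eq_zero_of_notMem_ball hy]) ht (hxs t htr.le) hLint
    rw [hLeq] at h
    rw [norm_mul, Real.norm_of_nonneg ht.le, Real.norm_eq_abs]
    have hte : t * t ^ (-(n : ℝ) / p) = t ^ (e - 1) := by
      rw [← Real.rpow_one_add' ht.le (by rw [neg_div]; linarith)]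
      congr 1
      rw [he]
      ring
    calc _ ≤ t * (K₂ * (t ^ (-(n : ℝ) / p) * N)) := mul_le_mul_of_nonneg_left h ht.le
      _ = K₂ * N * (1 * t ^ (e - 1)) := by rw [← hte]; ring
      _ ≤ _ := by gcongr
  have hMd := hasDerivAt_integral_dilate_mul_capBump hv x
  have hdiff : ‖M r - M 0‖ ≤ K₂ * N * r ^ e :=
    image_norm_le_of_norm_deriv_right_le_deriv_boundary (f := fun t => M t - M 0)
      (B := fun t => K₂ * N * t ^ e) (B' := fun t => K₂ * N * (e * t ^ (e - 1)))
      (fun t _ => ((hMd t).sub_const (M 0)).continuousAt.continuousWithinAt)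
      (fun t _ => ((hMd t).sub_const (M 0)).hasDerivWithinAt)
      (by simp [Real.zero_rpow (by linarith : e ≠ 0)])
      (fun t => (Real.hasDerivAt_rpow_const (Or.inr he1)).const_mul _)
      hbound (right_mem_Icc.2 hr.le)
  have hux : |u x| * c ≤ K₁ * (r ^ (-(n : ℝ) / 2) * L) + K₂ * N * r ^ e := by
    rw [← abs_of_pos hc0, ← abs_mul, ← hM0, ← Real.norm_eq_abs]
    have := norm_le_norm_add_norm_sub' (M 0) (M r)
    rw [norm_sub_rev, Real.norm_eq_abs (M r)] at this
    linarith
  rw [div_mul_eq_mul_div, le_div_iff₀ hc0]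
  refine hux.trans ?_
  have hA : 0 ≤ r ^ (-(n : ℝ) / 2) * L := by positivity
  have hB : 0 ≤ r ^ e * N := by positivity
  nlinarith [mul_nonneg hK₁0 hB, mul_nonneg hK₂0 hA]
end

section
/- Let n ≥ 1 and n < p < ∞. There exists a constant C, depending only on n and p, with the following property: for every x₀ ∈ ℝⁿ, all radii 0 < r < R, and every function u that is twice continuously differentiable on an open set containing the closed ball of center x₀ and radius 2R and satisfies Δu = f pointwise on B(x₀,2R) with f ∈ L^p(B(x₀,2R)), one has ∫_{B(x₀,r)} ‖∇u(x)‖² dx ≤ C R^{2 + n(1 − 2/p)} ‖f‖²_{L^p(B(x₀,2R))} + C (R − r)^{−2} ‖u‖²_{L²(B(x₀,2R))}. -/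
open MeasureTheory Metric Set

/-- The derivative of the smooth transition function is bounded. -/
theorem exists_abs_deriv_smoothTransition_le :
    ∃ M : ℝ, 0 < M ∧ ∀ t, |deriv Real.smoothTransition t| ≤ M := by
  have hs : ContDiff ℝ 1 Real.smoothTransition := Real.smoothTransition.contDiff (n := 1)
  obtain ⟨M, hM⟩ := (isCompact_Icc (a := (0 : ℝ)) (b := 1)).exists_bound_of_continuousOn
    (hs.continuous_deriv le_rfl).continuousOn
  refine ⟨max M 1, by positivity, fun t => ?_⟩
  rcases lt_or_ge t 0 with ht | ht
  · have : Real.smoothTransition =ᶠ[nhds t] fun _ => 0 := by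
      filter_upwards [Iio_mem_nhds ht] with y hy
      exact Real.smoothTransition.zero_of_nonpos (le_of_lt hy)
    rw [this.deriv_eq]
    simp
  rcases lt_or_ge 1 t with ht' | ht'
  · have : Real.smoothTransition =ᶠ[nhds t] fun _ => 1 := by
      filter_upwards [Ioi_mem_nhds ht'] with y hy
      exact Real.smoothTransition.one_of_one_le (le_of_lt hy)
    rw [this.deriv_eq]
    simp
  exact (hM t ⟨ht, ht'⟩).trans (le_max_left _ _)

/-- Smooth cutoff functions between concentric balls of radii `r < R`, with gradient of
size `(R - r)⁻¹`. -/
theorem exists_cutoff_ball (E : Type*) [NormedAddCommGroup E] [InnerProductSpace ℝ E] :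
    ∃ K : ℝ, 0 < K ∧ ∀ (x₀ : E) (r R : ℝ), 0 < r → r < R → ∃ η : E → ℝ,
      ContDiff ℝ 2 η ∧ (∀ x, 0 ≤ η x) ∧ (∀ x, η x ≤ 1) ∧ (∀ x ∈ ball x₀ r, η x = 1) ∧
      tsupport η ⊆ closedBall x₀ R ∧
      ∀ x ∈ ball x₀ (2 * R), ‖fderiv ℝ η x‖ ≤ K / (R - r) := by
  obtain ⟨M, hM0, hM⟩ := exists_abs_deriv_smoothTransition_le
  refine ⟨4 * M, by positivity, fun x₀ r R hr hrR => ?_⟩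
  have hd : 0 < R ^ 2 - r ^ 2 := by nlinarith
  have hs : ContDiff ℝ 2 Real.smoothTransition := Real.smoothTransition.contDiff (n := 2)
  refine ⟨fun x => Real.smoothTransition ((R ^ 2 - ‖x - x₀‖ ^ 2) / (R ^ 2 - r ^ 2)),
    ?_, fun x => Real.smoothTransition.nonneg _, fun x => Real.smoothTransition.le_one _,
    fun x hx => ?_, ?_, fun x hx => ?_⟩
  · refine hs.comp ((contDiff_const.sub ?_).div_const _)
    exact (contDiff_id.sub contDiff_const).norm_sq ℝ
  · apply Real.smoothTransition.one_of_one_le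
    rw [le_div_iff₀ hd]
    rw [mem_ball_iff_norm] at hx
    nlinarith [norm_nonneg (x - x₀)]
  · refine closure_minimal (fun x hx => ?_) isClosed_closedBall
    rw [mem_closedBall_iff_norm]
    by_contra! h
    refine hx (Real.smoothTransition.zero_of_nonpos (div_nonpos_of_nonpos_of_nonneg ?_ hd.le))
    nlinarith [norm_nonneg (x - x₀)]
  · rw [mem_ball_iff_norm] at hx
    have h1 : HasFDerivAt (fun x : E => ‖x - x₀‖ ^ 2) (2 • (innerSL ℝ (x - x₀))) x := by
      simpa using ((hasFDerivAt_id x).sub_const x₀).norm_sq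
    have h2 := ((h1.const_sub (R ^ 2)).mul_const (R ^ 2 - r ^ 2)⁻¹)
    have h3 := (hs.differentiable (by norm_num)
      ((R ^ 2 - ‖x - x₀‖ ^ 2) * (R ^ 2 - r ^ 2)⁻¹)).hasDerivAt.comp_hasFDerivAt x h2
    have h4 : fderiv ℝ (fun x => Real.smoothTransition
        ((R ^ 2 - ‖x - x₀‖ ^ 2) / (R ^ 2 - r ^ 2))) x = _ := h3.fderiv
    rw [h4, norm_smul, norm_smul, norm_neg, Real.norm_eq_abs, Real.norm_eq_abs, abs_inv,
      abs_of_pos hd, ← Nat.cast_smul_eq_nsmul ℝ, norm_smul, innerSL_apply_norm]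
    have h5 : (R ^ 2 - r ^ 2)⁻¹ * (‖((2 : ℕ) : ℝ)‖ * ‖x - x₀‖) ≤ 4 / (R - r) := by
      rw [inv_mul_le_iff₀ hd, mul_div_assoc', le_div_iff₀ (by linarith)]
      norm_num
      nlinarith [mul_pos hr (sub_pos.2 hrR), norm_nonneg (x - x₀)]
    calc _ ≤ M * (4 / (R - r)) := by gcongr; exact hM _
      _ = _ := by ring

/-- Multiplying by a function supported in an open set `U` extends smoothness from `U` to the
whole space. -/
theorem ContDiffOn.mul_of_tsupport_subset {E : Type*} [NormedAddCommGroup E] [NormedSpace ℝ E]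
    {k : WithTop ℕ∞} {η w : E → ℝ} {U : Set E} (hw : ContDiffOn ℝ k w U) (hη : ContDiff ℝ k η)
    (hU : IsOpen U) (h : tsupport η ⊆ U) : ContDiff ℝ k (fun x => η x * w x) := by
  rw [contDiff_iff_contDiffAt]
  intro x
  by_cases hx : x ∈ U
  · exact hη.contDiffAt.mul (hw.contDiffAt (hU.mem_nhds hx))
  · have : (fun x => η x * w x) =ᶠ[nhds x] fun _ => 0 := by
      filter_upwards [notMem_tsupport_iff_eventuallyEq.1 (fun hh => hx (h hh))] with y hy
      simp [hy]
    exact contDiffAt_const.congr_of_eventuallyEq this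

/-- The integral of a directional derivative of a compactly supported function vanishes. -/
theorem integral_fderiv_apply_eq_zero {E : Type*} [NormedAddCommGroup E] [NormedSpace ℝ E]
    [MeasurableSpace E] [BorelSpace E] [FiniteDimensional ℝ E] {μ : Measure E}
    [μ.IsAddHaarMeasure] {F : E → ℝ} (hF : ContDiff ℝ 1 F) (hc : HasCompactSupport F) (v : E) :
    ∫ x, fderiv ℝ F x v ∂μ = 0 := by
  have h1 : Integrable (fun x => fderiv ℝ F x v) μ :=
    ((hF.continuous_fderiv one_ne_zero).clm_apply continuous_const).integrable_of_hasCompactSupport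
      (hc.fderiv_apply ℝ v)
  have h2 : Integrable F μ := hF.continuous.integrable_of_hasCompactSupport hc
  have := integral_mul_fderiv_eq_neg_fderiv_mul_of_integrable (μ := μ) (f := fun _ => (1 : ℝ))
    (g := F) (v := v) (by simp) (by simpa using h1) (by simpa using h2)
    (fun x _ => by fun_prop) (fun x _ => hF.differentiable one_ne_zero x)
  simpa using this

/-- A compactly supported function in one dimension is bounded by the integral of its
derivative. -/
theorem abs_le_integral_abs_fderiv_of_dim_one {g : EuclideanSpace ℝ (Fin 1) → ℝ}
    (hg : ContDiff ℝ 1 g) (hc : HasCompactSupport g) (x : EuclideanSpace ℝ (Fin 1)) :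
    |g x| ≤ ∫ y, |fderiv ℝ g y (EuclideanSpace.single 0 1)| := by
  let L : ℝ ≃ₗᵢ[ℝ] EuclideanSpace ℝ (Fin 1) := (OrthonormalBasis.singleton (Fin 1) ℝ).repr
  have hL1 : L 1 = EuclideanSpace.single 0 1 := by
    ext i
    fin_cases i
    exact OrthonormalBasis.singleton_repr (ι := Fin 1) (𝕜 := ℝ) 1 0
  have hd : ∀ t, deriv (g ∘ L) t = fderiv ℝ g (L t) (EuclideanSpace.single 0 1) := by
    intro t
    have h := (hg.differentiable one_ne_zero (L t)).hasFDerivAt.comp_hasDerivAt t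
      (L.toContinuousLinearEquiv.hasFDerivAt (x := t)).hasDerivAt
    rw [← hL1]
    exact h.deriv
  have hgL : ContDiff ℝ 1 (g ∘ L) := hg.comp L.contDiff
  have hcL : HasCompactSupport (g ∘ L) := hc.comp_homeomorph L.toHomeomorph
  have h1 := hcL.enorm_le_lintegral_Ici_deriv hgL (L.symm x)
  have h2 : ‖(g ∘ L) (L.symm x)‖ₑ ≤ ∫⁻ y, ‖deriv (g ∘ L) y‖ₑ :=
    h1.trans (setLIntegral_le_lintegral _ _)
  have h3 : ∫ y, |fderiv ℝ g y (EuclideanSpace.single 0 1)| = ∫ t, ‖deriv (g ∘ L) t‖ := by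
    rw [← L.measurePreserving.integral_comp L.toHomeomorph.measurableEmbedding]
    simp [hd]
  have h4 : Integrable (deriv (g ∘ L)) :=
    (hgL.continuous_deriv le_rfl).integrable_of_hasCompactSupport hcL.deriv
  rw [h3, integral_norm_eq_lintegral_enorm h4.aestronglyMeasurable]
  have h5 := ENNReal.toReal_mono h4.2.ne h2
  simpa using h5

/-- Hölder's inequality against the constant function, for powers `a < b`. -/
theorem setIntegral_abs_rpow_le_of_lt {α : Type*} [MeasurableSpace α] {μ : Measure α} {B : Set α}
    {g : α → ℝ} {a b : ℝ} (ha : 0 < a) (hab : a < b) (hB : μ B ≠ ⊤)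
    (hg : AEStronglyMeasurable g (μ.restrict B)) (hb : IntegrableOn (fun x => |g x| ^ b) B μ) :
    ∫ x in B, |g x| ^ a ∂μ ≤ (∫ x in B, |g x| ^ b ∂μ) ^ (a / b) * μ.real B ^ (1 - a / b) := by
  have hb0 : 0 < b := ha.trans hab
  have : IsFiniteMeasure (μ.restrict B) := ⟨by simpa using hB.lt_top⟩
  have hpq : (b / a).HolderConjugate (b / a).conjExponent :=
    Real.HolderConjugate.conjExponent (by rwa [one_lt_div ha])
  have hm : MemLp (fun x => |g x| ^ a) (ENNReal.ofReal (b / a)) (μ.restrict B) := by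
    rw [← integrable_norm_rpow_iff]
    · refine hb.congr (Filter.Eventually.of_forall fun x => ?_)
      have : (0 : ℝ) ≤ |g x| ^ a := by positivity
      simp only [Real.norm_eq_abs, abs_of_nonneg this]
      rw [ENNReal.toReal_ofReal (by positivity), ← Real.rpow_mul (abs_nonneg _)]
      congr 1
      field_simp
    · exact (hg.norm.aemeasurable.pow_const a).aestronglyMeasurable
    · simp; positivity
    · simp
  have h := integral_mul_le_Lp_mul_Lq_of_nonneg (μ := μ.restrict B) hpq
    (f := fun x => |g x| ^ a) (g := fun _ => 1)
    (Filter.Eventually.of_forall fun x => by positivity)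
    (Filter.Eventually.of_forall fun x => by simp) hm (memLp_const 1)
  have e1 : ∀ x, (|g x| ^ a) ^ (b / a) = |g x| ^ b := fun x => by
    rw [← Real.rpow_mul (abs_nonneg _)]
    congr 1
    field_simp
  have e2 : 1 / (b / a).conjExponent = 1 - a / b := by
    have := hpq.inv_add_inv_eq_one
    rw [inv_div] at this
    rw [one_div]
    linarith
  simp only [mul_one, e1, e2, Real.one_rpow, integral_const, one_div_div, smul_eq_mul] at h
  simpa [measureReal_restrict_apply_univ] using h

/-- The Laplacian of a `C²` function is continuous. -/
theorem ContDiffOn.continuousOn_lap {n : ℕ} {u : EuclideanSpace ℝ (Fin n) → ℝ}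
    {U : Set (EuclideanSpace ℝ (Fin n))} (hu : ContDiffOn ℝ 2 u U) (hU : IsOpen U) :
    ContinuousOn (lap u) U :=
  continuousOn_finsetSum _ fun _ _ =>
    (((hu.fderiv_of_isOpen hU (m := 1) (by norm_num)).clm_apply
      contDiffOn_const).continuousOn_fderiv_of_isOpen hU le_rfl).clm_apply continuousOn_const

/-- Coordinatewise product rule for the field `η² u ∇u`, combined with Young's inequality. -/
theorem half_sq_mul_sum_sq_le_divergence {n : ℕ} {η u : EuclideanSpace ℝ (Fin n) → ℝ}
    {U : Set (EuclideanSpace ℝ (Fin n))} (hU : IsOpen U) (hu : ContDiffOn ℝ 2 u U)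
    (hη : ContDiff ℝ 2 η) {x : EuclideanSpace ℝ (Fin n)} (hx : x ∈ U) :
    η x ^ 2 * (∑ i, fderiv ℝ u x (EuclideanSpace.single i 1) ^ 2) / 2 ≤
      (∑ i, fderiv ℝ (fun y => η y * (η y * (u y * fderiv ℝ u y (EuclideanSpace.single i 1)))) x
        (EuclideanSpace.single i 1)) +
      2 * (u x ^ 2 * ∑ i, fderiv ℝ η x (EuclideanSpace.single i 1) ^ 2) +
      η x ^ 2 * |u x| * |lap u x| := by
  have hu1 : DifferentiableAt ℝ u x :=
    (hu.contDiffAt (hU.mem_nhds hx)).differentiableAt two_ne_zero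
  have hη1 : DifferentiableAt ℝ η x := hη.differentiable two_ne_zero x
  have hD : ∀ v, DifferentiableAt ℝ (fun y => fderiv ℝ u y v) x := fun v =>
    ((((hu.fderiv_of_isOpen hU (m := 1) (by norm_num)).contDiffAt
      (hU.mem_nhds hx)).differentiableAt one_ne_zero).clm_apply (differentiableAt_const v))
  have hF : ∀ v, fderiv ℝ (fun y => η y * (η y * (u y * fderiv ℝ u y v))) x v =
      2 * (η x * fderiv ℝ η x v * u x * fderiv ℝ u x v) + η x ^ 2 * fderiv ℝ u x v ^ 2 +
        η x ^ 2 * u x * fderiv ℝ (fun y => fderiv ℝ u y v) x v := by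
    intro v
    have h := hη1.hasFDerivAt.mul (hη1.hasFDerivAt.mul (hu1.hasFDerivAt.mul (hD v).hasFDerivAt))
    have h' : fderiv ℝ (fun y => η y * (η y * (u y * fderiv ℝ u y v))) x = _ := h.fderiv
    rw [h']
    simp only [_root_.add_apply, _root_.smul_apply, smul_eq_mul,
      Pi.mul_apply]
    ring
  have hlap : -(η x ^ 2 * |u x| * |lap u x|) ≤ η x ^ 2 * u x * lap u x := by
    have := neg_abs_le (u x * lap u x)
    rw [abs_mul] at this
    nlinarith [sq_nonneg (η x)]
  have hsum : η x ^ 2 * (∑ i, fderiv ℝ u x (EuclideanSpace.single i 1) ^ 2) / 2 ≤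
      (∑ i, (2 * (η x * fderiv ℝ η x (EuclideanSpace.single i 1) * u x *
        fderiv ℝ u x (EuclideanSpace.single i 1)) +
        η x ^ 2 * fderiv ℝ u x (EuclideanSpace.single i 1) ^ 2)) +
      2 * (u x ^ 2 * ∑ i, fderiv ℝ η x (EuclideanSpace.single i 1) ^ 2) := by
    simp only [Finset.mul_sum, Finset.sum_div, ← Finset.sum_add_distrib]
    refine Finset.sum_le_sum fun i _ => ?_
    nlinarith [sq_nonneg (η x * fderiv ℝ u x (EuclideanSpace.single i 1) +
      2 * (u x * fderiv ℝ η x (EuclideanSpace.single i 1)))]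
  simp only [hF]
  rw [Finset.sum_add_distrib, ← Finset.mul_sum]
  change _ ≤ _ + η x ^ 2 * u x * lap u x + _ + _
  linarith

/-- The weighted energy estimate behind the Caccioppoli inequality, with the right-hand side
`lap u` not yet estimated. -/
theorem half_setIntegral_sq_mul_sum_sq_le {n : ℕ} {η u : EuclideanSpace ℝ (Fin n) → ℝ}
    {U K B : Set (EuclideanSpace ℝ (Fin n))} (hU : IsOpen U) (hK : IsCompact K)
    (hB : MeasurableSet B) (hKU : K ⊆ U) (hBK : B ⊆ K) (hηB : tsupport η ⊆ B)
    (hu : ContDiffOn ℝ 2 u U) (hη : ContDiff ℝ 2 η) :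
    (∫ x in B, η x ^ 2 * ∑ i, fderiv ℝ u x (EuclideanSpace.single i 1) ^ 2) / 2 ≤
      2 * (∫ x in B, u x ^ 2 * ∑ i, fderiv ℝ η x (EuclideanSpace.single i 1) ^ 2) +
      ∫ x in B, η x ^ 2 * |u x| * |lap u x| := by
  have hηc : HasCompactSupport η := hK.of_isClosed_subset (isClosed_tsupport _) (hηB.trans hBK)
  have hint : ∀ h : EuclideanSpace ℝ (Fin n) → ℝ, ContinuousOn h U → IntegrableOn h B :=
    fun h hh => ((hh.mono hKU).integrableOn_compact hK).mono_set hBK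
  have hD : ∀ v, ContDiffOn ℝ 1 (fun x => fderiv ℝ u x v) U := fun v =>
    (hu.fderiv_of_isOpen hU (m := 1) (by norm_num)).clm_apply contDiffOn_const
  have hDη : ∀ v, Continuous (fun x => fderiv ℝ η x v) := fun v =>
    (hη.continuous_fderiv two_ne_zero).clm_apply continuous_const
  have hlap : ContinuousOn (lap u) U := hu.continuousOn_lap hU
  have hη1 : ContDiff ℝ 1 η := hη.of_le (by norm_num)
  have hF : ∀ v, ContDiff ℝ 1 (fun y => η y * (η y * (u y * fderiv ℝ u y v))) := fun v =>
    (hη1.contDiffOn.mul ((hu.of_le (by norm_num)).mul (hD v))).mul_of_tsupport_subset hη1 hU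
      (hηB.trans (hBK.trans hKU))
  have hFc : ∀ v, HasCompactSupport (fun y => η y * (η y * (u y * fderiv ℝ u y v))) :=
    fun v => hηc.mul_right
  have hFd : ∀ v, Continuous
      (fun x => fderiv ℝ (fun y => η y * (η y * (u y * fderiv ℝ u y v))) x v) :=
    fun v => ((hF v).continuous_fderiv one_ne_zero).clm_apply continuous_const
  have hdiv : ∫ x in B, ∑ i, fderiv ℝ (fun y => η y * (η y * (u y *
      fderiv ℝ u y (EuclideanSpace.single i 1)))) x (EuclideanSpace.single i 1) = 0 := by
    rw [setIntegral_eq_integral_of_forall_compl_eq_zero, integral_finsetSum]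
    · exact Finset.sum_eq_zero fun i _ => integral_fderiv_apply_eq_zero (hF _) (hFc _) _
    · exact fun i _ => (hFd _).integrable_of_hasCompactSupport ((hFc _).fderiv_apply ℝ _)
    · intro x hx
      refine Finset.sum_eq_zero fun i _ => ?_
      have h0 : (fun y => η y * (η y * (u y * fderiv ℝ u y (EuclideanSpace.single i 1)))) =ᶠ[nhds x]
          fun _ => 0 := by
        filter_upwards [notMem_tsupport_iff_eventuallyEq.1 (fun hh => hx (hηB hh))] with y hy
        simp [hy]
      rw [h0.fderiv_eq]
      simp
  have i1 := hint (fun x => η x ^ 2 * ∑ i, fderiv ℝ u x (EuclideanSpace.single i 1) ^ 2)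
    ((hη.continuous.continuousOn.pow 2).mul
      (continuousOn_finsetSum _ fun i _ => (hD _).continuousOn.pow 2))
  have i2 := hint (fun x => u x ^ 2 * ∑ i, fderiv ℝ η x (EuclideanSpace.single i 1) ^ 2)
    ((hu.continuousOn.pow 2).mul
      (continuousOn_finsetSum _ fun i _ => (hDη _).continuousOn.pow 2))
  have i3 := hint (fun x => η x ^ 2 * |u x| * |lap u x|)
    (((hη.continuous.continuousOn.pow 2).mul hu.continuousOn.abs).mul hlap.abs)
  have i4 := hint (fun x => ∑ i, fderiv ℝ (fun y => η y * (η y * (u y *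
      fderiv ℝ u y (EuclideanSpace.single i 1)))) x (EuclideanSpace.single i 1))
    (continuousOn_finsetSum _ fun i _ => (hFd _).continuousOn)
  have := setIntegral_mono_on (i1.div_const 2) ((i4.add (i2.const_mul 2)).add i3) hB
    fun x hx => half_sq_mul_sum_sq_le_divergence hU hu hη (hKU (hBK hx))
  have e := integral_add (i4.add (i2.const_mul 2)) i3
  simp only [Pi.add_apply] at this e
  rwa [integral_div, e, integral_add i4 (i2.const_mul 2), hdiv, zero_add,
    integral_const_mul] at this

/-- For `p > 2`, the source term is controlled by Young's and Hölder's inequalities. -/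
theorem setIntegral_sq_mul_abs_mul_abs_le_of_two_lt {n : ℕ}
    {η u g : EuclideanSpace ℝ (Fin n) → ℝ} {U K B : Set (EuclideanSpace ℝ (Fin n))}
    (hK : IsCompact K) (hB : MeasurableSet B) (hKU : K ⊆ U) (hBK : B ⊆ K)
    (hu : ContinuousOn u U) (hη : Continuous η) (hg : ContinuousOn g U)
    (hη0 : ∀ x, 0 ≤ η x) (hη1 : ∀ x, η x ≤ 1) {p : ℝ} (hp : 2 < p) {R : ℝ} (hR : 0 < R) :
    ∫ x in B, η x ^ 2 * |u x| * |g x| ≤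
      (∫ x in B, u x ^ 2) / R ^ 2 +
      R ^ 2 * volume.real B ^ (1 - 2 / p) * (∫ x in B, |g x| ^ p) ^ (2 / p) := by
  have hint : ∀ h : EuclideanSpace ℝ (Fin n) → ℝ, ContinuousOn h U → IntegrableOn h B :=
    fun h hh => ((hh.mono hKU).integrableOn_compact hK).mono_set hBK
  have i1 := hint _ (((hη.continuousOn.pow 2).mul hu.abs).mul hg.abs)
  have i2 := hint (fun x => u x ^ 2) (hu.pow 2)
  have i3 := hint (fun x => g x ^ 2) (hg.pow 2)
  have i4 := hint (fun x => |g x| ^ p) (hg.abs.rpow_const fun x _ => Or.inr (by linarith))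
  have hH := setIntegral_abs_rpow_le_of_lt two_pos hp
    ((measure_mono hBK).trans_lt hK.measure_lt_top).ne (hint _ hg).aestronglyMeasurable i4
  simp only [Real.rpow_two, sq_abs] at hH
  have h : ∫ x in B, η x ^ 2 * |u x| * |g x| ≤ ∫ x in B, (u x ^ 2 / R ^ 2 + R ^ 2 * g x ^ 2) := by
    refine setIntegral_mono_on i1 ((i2.div_const _).add (i3.const_mul _)) hB fun x _ => ?_
    have h1 : η x ^ 2 * |u x| * |g x| ≤ |u x| * |g x| := by
      have := pow_le_one₀ (n := 2) (hη0 x) (hη1 x)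
      nlinarith [mul_nonneg (abs_nonneg (u x)) (abs_nonneg (g x))]
    have h2 : u x ^ 2 / R ^ 2 = (|u x| / R) ^ 2 := by rw [div_pow, sq_abs]
    have h3 : R ^ 2 * g x ^ 2 = (R * |g x|) ^ 2 := by rw [mul_pow, sq_abs]
    have h4 : |u x| * |g x| = (|u x| / R) * (R * |g x|) := by field_simp
    rw [h2, h3]
    rw [h4] at h1
    nlinarith [sq_nonneg (|u x| / R - R * |g x|), sq_nonneg (|u x| / R + R * |g x|)]
  rw [integral_add (i2.div_const _) (i3.const_mul _), integral_div, integral_const_mul] at h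
  have := mul_le_mul_of_nonneg_left hH (sq_nonneg R)
  linarith

/-- In dimension one, the source term is controlled for every `p > 1` through the embedding of
`W^{1,1}` into bounded functions. -/
theorem setIntegral_sq_mul_abs_mul_abs_le_of_dim_one {η u g : EuclideanSpace ℝ (Fin 1) → ℝ}
    {U K B : Set (EuclideanSpace ℝ (Fin 1))} (hU : IsOpen U) (hK : IsCompact K)
    (hB : MeasurableSet B) (hKU : K ⊆ U) (hBK : B ⊆ K) (hηB : tsupport η ⊆ B)
    (hu : ContDiffOn ℝ 2 u U) (hη : ContDiff ℝ 2 η) (hg : ContinuousOn g U)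
    (hη0 : ∀ x, 0 ≤ η x) (hη1 : ∀ x, η x ≤ 1) {p : ℝ} (hp : 1 < p)
    (hV : 0 < volume.real B) :
    ∫ x in B, η x ^ 2 * |u x| * |g x| ≤
      (∫ x in B, η x ^ 2 * ∑ i, fderiv ℝ u x (EuclideanSpace.single i 1) ^ 2) / 4 +
      (∫ x in B, u x ^ 2 * ∑ i, fderiv ℝ η x (EuclideanSpace.single i 1) ^ 2) / 4 +
      2 * volume.real B ^ 2 * volume.real B ^ (1 - 2 / p) *
        (∫ x in B, |g x| ^ p) ^ (2 / p) := by
  have hηc : HasCompactSupport η := hK.of_isClosed_subset (isClosed_tsupport _) (hηB.trans hBK)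
  have hint : ∀ h : EuclideanSpace ℝ (Fin 1) → ℝ, ContinuousOn h U → IntegrableOn h B :=
    fun h hh => ((hh.mono hKU).integrableOn_compact hK).mono_set hBK
  have hBfin : volume B ≠ ⊤ := ((measure_mono hBK).trans_lt hK.measure_lt_top).ne
  have hD : ContinuousOn (fun x => fderiv ℝ u x (EuclideanSpace.single 0 1)) U :=
    (hu.continuousOn_fderiv_of_isOpen hU one_le_two).clm_apply continuousOn_const
  have hDη : Continuous (fun x => fderiv ℝ η x (EuclideanSpace.single 0 1)) :=
    (hη.continuous_fderiv two_ne_zero).clm_apply continuous_const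
  have hv : ContDiff ℝ 1 (fun x => η x * u x) :=
    (hu.of_le one_le_two).mul_of_tsupport_subset (hη.of_le one_le_two) hU
      (hηB.trans (hBK.trans hKU))
  have hvc : HasCompactSupport (fun x => η x * u x) := hηc.mul_right
  have hDv : Continuous (fun x => fderiv ℝ (fun y => η y * u y) x (EuclideanSpace.single 0 1)) :=
    (hv.continuous_fderiv one_ne_zero).clm_apply continuous_const
  set S := ∫ x in B, |fderiv ℝ (fun y => η y * u y) x (EuclideanSpace.single 0 1)| with hS
  have hvS : ∀ x, |η x * u x| ≤ S := by
    intro x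
    refine (abs_le_integral_abs_fderiv_of_dim_one hv hvc x).trans_eq ?_
    refine (setIntegral_eq_integral_of_forall_compl_eq_zero fun y hy => ?_).symm
    have h0 : (fun y => η y * u y) =ᶠ[nhds y] fun _ => 0 := by
      filter_upwards [notMem_tsupport_iff_eventuallyEq.1 (fun hh => hy (hηB hh))] with z hz
      simp [hz]
    rw [h0.fderiv_eq]
    simp
  have i1 := hint (fun x => η x ^ 2 * fderiv ℝ u x (EuclideanSpace.single 0 1) ^ 2)
    ((hη.continuous.continuousOn.pow 2).mul (hD.pow 2))
  have i2 := hint (fun x => u x ^ 2 * fderiv ℝ η x (EuclideanSpace.single 0 1) ^ 2)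
    ((hu.continuousOn.pow 2).mul (hDη.continuousOn.pow 2))
  have i3 := hint
    (fun x => fderiv ℝ (fun y => η y * u y) x (EuclideanSpace.single 0 1) ^ 2)
    (hDv.continuousOn.pow 2)
  have i4 := hint (fun x => |g x| ^ p) (hg.abs.rpow_const fun x _ => Or.inr (by linarith))
  have hT : ∫ x in B, η x ^ 2 * |u x| * |g x| ≤ S * ∫ x in B, |g x| := by
    rw [← integral_const_mul]
    refine setIntegral_mono_on
      (hint _ (((hη.continuous.continuousOn.pow 2).mul hu.continuousOn.abs).mul hg.abs))
      ((hint _ hg.abs).const_mul _) hB fun x _ => ?_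
    have h1 := hvS x
    rw [abs_mul, abs_of_nonneg (hη0 x)] at h1
    have h2 : η x ^ 2 * |u x| ≤ η x * |u x| := by
      have := mul_le_mul_of_nonneg_right (hη1 x) (mul_nonneg (hη0 x) (abs_nonneg (u x)))
      nlinarith
    exact mul_le_mul_of_nonneg_right (h2.trans h1) (abs_nonneg _)
  have hY : ∫ x in B, fderiv ℝ (fun y => η y * u y) x (EuclideanSpace.single 0 1) ^ 2 ≤
      2 * (∫ x in B, η x ^ 2 * fderiv ℝ u x (EuclideanSpace.single 0 1) ^ 2) +
      2 * ∫ x in B, u x ^ 2 * fderiv ℝ η x (EuclideanSpace.single 0 1) ^ 2 := by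
    rw [← integral_const_mul, ← integral_const_mul,
      ← integral_add (i1.const_mul _) (i2.const_mul _)]
    refine setIntegral_mono_on i3 ((i1.const_mul _).add (i2.const_mul _)) hB fun x hx => ?_
    have h : fderiv ℝ (fun y => η y * u y) x = _ :=
      ((hη.differentiable two_ne_zero x).hasFDerivAt.mul
        ((hu.contDiffAt (hU.mem_nhds (hKU (hBK hx)))).differentiableAt two_ne_zero).hasFDerivAt).fderiv
    rw [h]
    simp only [_root_.add_apply, _root_.smul_apply, smul_eq_mul]
    nlinarith [sq_nonneg (η x * fderiv ℝ u x (EuclideanSpace.single 0 1) -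
      u x * fderiv ℝ η x (EuclideanSpace.single 0 1))]
  have hS2 : S ^ 2 ≤ volume.real B *
      ∫ x in B, fderiv ℝ (fun y => η y * u y) x (EuclideanSpace.single 0 1) ^ 2 := by
    have h := setIntegral_abs_rpow_le_of_lt one_pos one_lt_two hBfin
      (hint _ hDv.continuousOn).aestronglyMeasurable (by simpa using i3)
    simp only [Real.rpow_one, Real.rpow_two, sq_abs] at h
    have h' := pow_le_pow_left₀ (integral_nonneg fun x => abs_nonneg _) h 2
    rw [mul_pow, ← Real.rpow_mul_natCast (integral_nonneg fun x => sq_nonneg _),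
      ← Real.rpow_mul_natCast hV.le] at h'
    norm_num at h'
    linarith
  have hN2 : (∫ x in B, |g x|) ^ 2 ≤
      (∫ x in B, |g x| ^ p) ^ (2 / p) * (volume.real B * volume.real B ^ (1 - 2 / p)) := by
    have h := setIntegral_abs_rpow_le_of_lt one_pos hp hBfin (hint _ hg).aestronglyMeasurable i4
    simp only [Real.rpow_one] at h
    have h' := pow_le_pow_left₀ (integral_nonneg fun x => abs_nonneg _) h 2
    rw [mul_pow, ← Real.rpow_mul_natCast (integral_nonneg fun x => by positivity),
      ← Real.rpow_mul_natCast hV.le] at h'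
    have e1 : 1 / p * ((2 : ℕ) : ℝ) = 2 / p := by push_cast; ring
    have e2 : (1 - 1 / p) * ((2 : ℕ) : ℝ) = 1 + (1 - 2 / p) := by push_cast; ring
    rwa [e1, e2, Real.rpow_add hV, Real.rpow_one] at h'
  set N := ∫ x in B, |g x|
  have hSN : S * N ≤ S ^ 2 / (8 * volume.real B) + 2 * volume.real B * N ^ 2 := by
    have h1 : S ^ 2 / (8 * volume.real B) + 2 * volume.real B * N ^ 2 - S * N =
        (S - 4 * volume.real B * N) ^ 2 / (8 * volume.real B) := by
      field_simp
      ring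
    have h2 : 0 ≤ (S - 4 * volume.real B * N) ^ 2 / (8 * volume.real B) := by positivity
    linarith
  have hS3 : S ^ 2 / (8 * volume.real B) ≤
      (∫ x in B, fderiv ℝ (fun y => η y * u y) x (EuclideanSpace.single 0 1) ^ 2) / 8 := by
    rw [div_le_div_iff₀ (by positivity) (by norm_num)]
    linarith
  have hN3 := mul_le_mul_of_nonneg_left hN2 (mul_nonneg zero_le_two hV.le)
  simp only [Fin.sum_univ_one]
  linarith

/-- Euclidean, classical-solution case of Lemma 2.2 (Caccioppoli inequality):
`∫_{B(x₀,r)} ‖∇u‖² ≤ C R^{2+n(1-2/p)} ‖f‖²_{L^p(B(x₀,2R))} + C (R-r)^{-2} ‖u‖²_{L²(B(x₀,2R))}`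
for classical solutions of `Δu = f` with `f ∈ L^p`, `p > n`. -/
theorem poisson_caccioppoli
    (n : ℕ) (hn : 1 ≤ n) (p : ℝ) (hp : (n : ℝ) < p) :
    ∃ C : ℝ, 0 < C ∧
      ∀ (x₀ : EuclideanSpace ℝ (Fin n)) (r R : ℝ), 0 < r → r < R →
      ∀ (u f : EuclideanSpace ℝ (Fin n) → ℝ),
      (∃ U : Set (EuclideanSpace ℝ (Fin n)), IsOpen U ∧ closedBall x₀ (2 * R) ⊆ U ∧
        ContDiffOn ℝ 2 u U) →
      (∀ x ∈ ball x₀ (2 * R), lap u x = f x) →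
      IntegrableOn (fun x => |f x| ^ p) (ball x₀ (2 * R)) →
      ∫ x in ball x₀ r, ‖gradient u x‖ ^ 2 ≤
        C * R ^ (2 + (n : ℝ) * (1 - 2 / p)) *
            ((∫ z in ball x₀ (2 * R), |f z| ^ p) ^ (1 / p)) ^ 2
          + C * (R - r) ^ (-(2 : ℝ)) *
            ((∫ z in ball x₀ (2 * R), (u z) ^ 2) ^ ((1 : ℝ) / 2)) ^ 2 := by
  obtain ⟨K, hK0, hK⟩ := exists_cutoff_ball (EuclideanSpace ℝ (Fin n))
  have : Nonempty (Fin n) := ⟨⟨0, hn⟩⟩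
  set ω := volume.real (ball (0 : EuclideanSpace ℝ (Fin n)) 1) with hω
  have hω0 : 0 < ω := ENNReal.toReal_pos (measure_ball_pos _ _ one_pos).ne' measure_ball_lt_top.ne
  set c := (2 ^ n * ω) ^ (1 - 2 / p) with hc
  have hc0 : 0 < c := by positivity
  refine ⟨12 * (n * K ^ 2) + 4 + 4 * (1 + 8 * ω ^ 2) * c, by positivity, ?_⟩
  rintro x₀ r R hr hrR u f ⟨U, hU, hBU, hu⟩ hf -
  have hR : 0 < R := hr.trans hrR
  obtain ⟨η, hη, hη0, hη1, hηr, hηs, hηd⟩ := hK x₀ r R hr hrR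
  set B := ball x₀ (2 * R) with hB
  have hBm : MeasurableSet B := measurableSet_ball
  have hBK : B ⊆ closedBall x₀ (2 * R) := ball_subset_closedBall
  have hcpt : IsCompact (closedBall x₀ (2 * R)) := isCompact_closedBall _ _
  have hηB : tsupport η ⊆ B := hηs.trans (closedBall_subset_ball (by linarith))
  have hint : ∀ h : EuclideanSpace ℝ (Fin n) → ℝ, ContinuousOn h U → IntegrableOn h B :=
    fun h hh => ((hh.mono hBU).integrableOn_compact hcpt).mono_set hBK
  have hD : ∀ v, ContinuousOn (fun x => fderiv ℝ u x v) U := fun v =>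
    (hu.continuousOn_fderiv_of_isOpen hU one_le_two).clm_apply continuousOn_const
  have hDη : ∀ v, Continuous (fun x => fderiv ℝ η x v) := fun v =>
    (hη.continuous_fderiv two_ne_zero).clm_apply continuous_const
  have hlap : ContinuousOn (lap u) U := hu.continuousOn_lap hU
  have hV : volume.real B = (2 * R) ^ n * ω := by
    rw [hB, hω, measureReal_def, Measure.addHaar_ball _ _ (by positivity), ENNReal.toReal_mul,
      ENNReal.toReal_ofReal (by positivity), finrank_euclideanSpace_fin, measureReal_def]
  have hV0 : 0 < volume.real B := by rw [hV]; positivity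
  have hVp : volume.real B ^ (1 - 2 / p) = c * R ^ (n * (1 - 2 / p)) := by
    rw [hV, hc, Real.rpow_natCast_mul hR.le, ← Real.mul_rpow (by positivity) (by positivity)]
    congr 1
    ring
  have hfG : ∫ z in B, |f z| ^ p = ∫ z in B, |lap u z| ^ p :=
    setIntegral_congr_fun hBm fun x hx => by simp only [hf x hx]
  set G := (∫ z in B, |lap u z| ^ p) ^ (2 / p) with hG
  have hG0 : 0 ≤ G := Real.rpow_nonneg (integral_nonneg fun x => by positivity) _
  set W := ∫ z in B, u z ^ 2 with hW
  have hW0 : 0 ≤ W := integral_nonneg fun x => sq_nonneg _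
  have henergy := half_setIntegral_sq_mul_sum_sq_le hU hcpt hBm hBU hBK hηB hu hη
  set X := ∫ x in B, η x ^ 2 * ∑ i, fderiv ℝ u x (EuclideanSpace.single i 1) ^ 2 with hX
  set Z := ∫ x in B, u x ^ 2 * ∑ i, fderiv ℝ η x (EuclideanSpace.single i 1) ^ 2 with hZ
  set T := ∫ x in B, η x ^ 2 * |u x| * |lap u x| with hT
  have hX0 : 0 ≤ X := integral_nonneg fun x => by positivity
  have hZ0 : 0 ≤ Z := integral_nonneg fun x => by positivity
  have hsource : T ≤ X / 4 + Z / 4 + W / R ^ 2 +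
      (1 + 8 * ω ^ 2) * (R ^ 2 * volume.real B ^ (1 - 2 / p) * G) := by
    have hE : 0 ≤ R ^ 2 * volume.real B ^ (1 - 2 / p) * G := by positivity
    rcases hn.eq_or_lt with h1 | h1
    · subst h1
      have h := setIntegral_sq_mul_abs_mul_abs_le_of_dim_one hU hcpt hBm hBU hBK hηB hu hη hlap
        hη0 hη1 (by simpa using hp) hV0
      have e : 2 * volume.real B ^ 2 * volume.real B ^ (1 - 2 / p) * G =
          8 * ω ^ 2 * (R ^ 2 * volume.real B ^ (1 - 2 / p) * G) := by
        have : volume.real B ^ 2 = 4 * ω ^ 2 * R ^ 2 := by rw [hV]; ring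
        rw [this]
        ring
      have hWR : 0 ≤ W / R ^ 2 := by positivity
      linarith
    · have hp2 : (2 : ℝ) < p := lt_of_le_of_lt (by exact_mod_cast h1) hp
      have h := setIntegral_sq_mul_abs_mul_abs_le_of_two_lt hcpt hBm hBU hBK hu.continuousOn
        hη.continuous hlap hη0 hη1 hp2 hR
      have : 0 ≤ 8 * ω ^ 2 * (R ^ 2 * volume.real B ^ (1 - 2 / p) * G) := by positivity
      linarith
  have hZW : Z ≤ n * K ^ 2 * ((R - r) ^ 2)⁻¹ * W := by
    rw [hZ, hW, ← integral_const_mul]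
    refine setIntegral_mono_on (hint _ ((hu.continuousOn.pow 2).mul
      (continuousOn_finsetSum _ fun i _ => (hDη _).continuousOn.pow 2)))
      ((hint _ (hu.continuousOn.pow 2)).const_mul _) hBm fun x hx => ?_
    have h1 : ∀ i, fderiv ℝ η x (EuclideanSpace.single i 1) ^ 2 ≤ (K / (R - r)) ^ 2 := fun i => by
      rw [← sq_abs]
      refine pow_le_pow_left₀ (abs_nonneg _) (le_trans ?_ (hηd x hx)) 2
      simpa using (fderiv ℝ η x).le_opNorm (EuclideanSpace.single i 1)
    have h2 := Finset.sum_le_sum fun i (_ : i ∈ Finset.univ) => h1 i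
    simp only [Finset.sum_const, Finset.card_univ, Fintype.card_fin, nsmul_eq_mul] at h2
    calc _ ≤ u x ^ 2 * (n * (K / (R - r)) ^ 2) := by gcongr
      _ = _ := by rw [div_pow]; ring
  have hWR : W / R ^ 2 ≤ ((R - r) ^ 2)⁻¹ * W := by
    rw [div_eq_inv_mul]
    have : 0 < R - r := sub_pos.2 hrR
    gcongr
    linarith
  have hgrad : ∀ x, ‖gradient u x‖ ^ 2 = ∑ i, fderiv ℝ u x (EuclideanSpace.single i 1) ^ 2 := by
    intro x
    rw [EuclideanSpace.norm_sq_eq]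
    refine Finset.sum_congr rfl fun i _ => ?_
    rw [← inner_gradient_left, EuclideanSpace.inner_single_right]
    simp
  have hLX : ∫ x in ball x₀ r, ‖gradient u x‖ ^ 2 ≤ X := by
    calc _ = ∫ x in ball x₀ r, η x ^ 2 * ∑ i, fderiv ℝ u x (EuclideanSpace.single i 1) ^ 2 :=
          setIntegral_congr_fun measurableSet_ball fun x hx => by simp [hgrad, hηr x hx]
      _ ≤ X := setIntegral_mono_set
          (hint _ ((hη.continuous.continuousOn.pow 2).mul
            (continuousOn_finsetSum _ fun i _ => (hD _).pow 2)))
          (Filter.Eventually.of_forall fun x => by simp only [Pi.zero_apply]; positivity)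
          (ball_subset_ball (by linarith)).eventuallyLE
  have hGe : ((∫ z in B, |f z| ^ p) ^ (1 / p)) ^ 2 = G := by
    rw [hfG, hG, ← Real.rpow_mul_natCast (integral_nonneg fun x => by positivity)]
    congr 1
    push_cast
    ring
  have hWe : (W ^ ((1 : ℝ) / 2)) ^ 2 = W := by
    rw [← Real.sqrt_eq_rpow, Real.sq_sqrt hW0]
  have hRe : R ^ (2 + (n : ℝ) * (1 - 2 / p)) = R ^ 2 * R ^ ((n : ℝ) * (1 - 2 / p)) := by
    rw [Real.rpow_add hR, Real.rpow_two]
  have hre : (R - r) ^ (-(2 : ℝ)) = ((R - r) ^ 2)⁻¹ := by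
    rw [Real.rpow_neg (sub_pos.2 hrR).le, Real.rpow_two]
  rw [hGe, hWe, hre, hRe]
  rw [hVp] at hsource
  have hP : 0 ≤ R ^ 2 * R ^ ((n : ℝ) * (1 - 2 / p)) * G := by positivity
  have hQ : 0 ≤ ((R - r) ^ 2)⁻¹ * W := by positivity
  have h1 : X ≤ 4 * (1 + 8 * ω ^ 2) * c * (R ^ 2 * R ^ ((n : ℝ) * (1 - 2 / p)) * G) +
      (12 * (n * K ^ 2) + 4) * (((R - r) ^ 2)⁻¹ * W) := by
    linarith
  have h2 : 0 ≤ (12 * (n * K ^ 2) + 4) * (R ^ 2 * R ^ ((n : ℝ) * (1 - 2 / p)) * G) := by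
    positivity
  have h3 : 0 ≤ 4 * (1 + 8 * ω ^ 2) * c * (((R - r) ^ 2)⁻¹ * W) := by positivity
  linarith
end
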